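/- arXiv:2408.15030 — 7 statements merged into one kernel-verified Lean document; each statement's English description precedes it below -/
import Mathlib

section
/- Let N > 1 be a real number, let a < 0 < b be real numbers, and let w : (a,b) → [0,∞) be an integrable function such that x ↦ w(x)^{1/(N-1)} is concave on (a,b), ∫_a^b w(x) dx = 1, and ∫_a^b x·w(x) dx = 0. Then ∫_a^0 w(x) dx ≥ (N/(N+1))^N and ∫_0^b w(x) dx ≥ (N/(N+1))^N. -/
open MeasureTheory

/-- The integral of a power of a nonnegative affine function with nonzero slope. -/
lemma integral_affine_rpow {N k c x u v : ℝ} (hN : 1 < N) (hk : k ≠ 0) :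
    ∫ t in u..v, (c + k * (t - x)) ^ (N - 1) =
      ((c + k * (v - x)) ^ N - (c + k * (u - x)) ^ N) / (N * k) := by
  have hN0 : N ≠ 0 := by linarith
  have hcont : Continuous fun t : ℝ => (c + k * (t - x)) ^ (N - 1) :=
    Continuous.rpow_const (by fun_prop) fun _ => Or.inr (by linarith)
  rw [intervalIntegral.integral_eq_sub_of_hasDerivAt
    (f := fun t => (c + k * (t - x)) ^ N / (N * k)) ?_ (hcont.intervalIntegrable _ _), sub_div]
  intro t _
  have h1 : HasDerivAt (fun t : ℝ => c + k * (t - x)) k t := by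
    simpa using (((hasDerivAt_id t).sub_const x).const_mul k).const_add c
  exact ((h1.rpow_const (p := N) (Or.inr hN.le)).div_const (N * k)).congr_deriv (by field_simp)

lemma ConcaveOn.le_secant_of_lt {s : Set ℝ} {f : ℝ → ℝ} (hf : ConcaveOn ℝ s f) {x y t : ℝ}
    (ht : t ∈ s) (hy : y ∈ s) (htx : t < x) (hxy : x < y) :
    f t ≤ f x + (f y - f x) / (y - x) * (t - x) := by
  have h := hf.slope_anti_adjacent ht hy htx hxy
  rw [le_div_iff₀ (by linarith)] at h
  linarith

lemma ConcaveOn.secant_le {s : Set ℝ} {f : ℝ → ℝ} (hf : ConcaveOn ℝ s f) {x y t : ℝ}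
    (hx : x ∈ s) (hy : y ∈ s) (hxt : x ≤ t) (hty : t ≤ y) (hxy : x < y) :
    f x + (f y - f x) / (y - x) * (t - x) ≤ f t := by
  have hd : 0 < y - x := by linarith
  have h := hf.2 hx hy
    (div_nonneg (sub_nonneg.2 hty) hd.le) (div_nonneg (sub_nonneg.2 hxt) hd.le) (by field_simp; ring)
  simp only [smul_eq_mul] at h
  have h1 : (y - t) / (y - x) * x + (t - x) / (y - x) * y = t := by
    field_simp
    ring
  rw [h1] at h
  refine le_of_eq_of_le ?_ h
  field_simp
  ring

/-- For a positive concave `f`, the ratio of `f ^ N` to the primitive of `f ^ (N - 1)`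
is nonincreasing. -/
lemma rpow_mul_integral_rpow_le {N a b x y : ℝ} {f : ℝ → ℝ} (hN : 1 < N)
    (hf : ConcaveOn ℝ (Set.Ioo a b) f) (hpos : ∀ t ∈ Set.Ioo a b, 0 < f t)
    (hint : IntervalIntegrable (fun t => f t ^ (N - 1)) volume a b)
    (hax : a < x) (hxy : x < y) (hyb : y < b) :
    f y ^ N * ∫ t in a..x, f t ^ (N - 1) ≤ f x ^ N * ∫ t in a..y, f t ^ (N - 1) := by
  have hxm : x ∈ Set.Ioo a b := ⟨hax, hxy.trans hyb⟩
  have hym : y ∈ Set.Ioo a b := ⟨hax.trans hxy, hyb⟩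
  have hp := hpos x hxm
  have hq := hpos y hym
  have hN0 : 0 < N := by linarith
  have hpN : 0 < f x ^ N := Real.rpow_pos_of_pos hp N
  have hab : a ≤ b := (hax.trans (hxy.trans hyb)).le
  have hiax : IntervalIntegrable (fun t => f t ^ (N - 1)) volume a x :=
    hint.mono_set (by
      rw [Set.uIcc_of_le hab, Set.uIcc_of_le hax.le]
      exact Set.Icc_subset_Icc le_rfl (hxy.trans hyb).le)
  have hixy : IntervalIntegrable (fun t => f t ^ (N - 1)) volume x y :=
    hint.mono_set (by
      rw [Set.uIcc_of_le hab, Set.uIcc_of_le hxy.le]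
      exact Set.Icc_subset_Icc hax.le hyb.le)
  rw [← intervalIntegral.integral_add_adjacent_intervals hiax hixy]
  have hI : 0 ≤ ∫ t in a..x, f t ^ (N - 1) := by
    simpa using intervalIntegral.integral_mono_on_of_le_Ioo hax.le intervalIntegrable_const hiax
      fun t ht => (Real.rpow_pos_of_pos (hpos t ⟨ht.1, ht.2.trans hxm.2⟩) (N - 1)).le
  rcases le_or_gt (f y) (f x) with hle | hlt
  · have hJ : 0 ≤ ∫ t in x..y, f t ^ (N - 1) :=
      intervalIntegral.integral_nonneg hxy.le fun t ht =>
        (Real.rpow_pos_of_pos (hpos t ⟨hax.trans_le ht.1, ht.2.trans_lt hyb⟩) (N - 1)).le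
    exact mul_le_mul (Real.rpow_le_rpow hq.le hle hN0.le) (by linarith) hI hpN.le
  · set k := (f y - f x) / (y - x) with hk
    have hk0 : 0 < k := div_pos (by linarith) (by linarith)
    have hky : f x + k * (y - x) = f y := by
      rw [hk, div_mul_cancel₀ _ (by linarith)]
      ring
    have hline : ∀ t ∈ Set.Ioo a x, f t ≤ f x + k * (t - x) := fun t ht =>
      hf.le_secant_of_lt ⟨ht.1, ht.2.trans hxm.2⟩ hym ht.2 hxy
    have hla : 0 ≤ f x + k * (a - x) := by
      by_contra! hneg
      have hd : 0 < -(f x + k * (a - x)) / (2 * k) := div_pos (by linarith) (by linarith)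
      have he : k * (-(f x + k * (a - x)) / (2 * k)) = -(f x + k * (a - x)) / 2 := by
        field_simp
      have hx' : a + -(f x + k * (a - x)) / (2 * k) < x := by
        refine lt_of_mul_lt_mul_left ?_ hk0.le
        linarith
      have hm : a + -(f x + k * (a - x)) / (2 * k) ∈ Set.Ioo a x := ⟨by linarith, hx'⟩
      have := hline _ hm
      have := hpos _ ⟨hm.1, hm.2.trans hxm.2⟩
      linarith
    have hcont : Continuous fun t : ℝ => (f x + k * (t - x)) ^ (N - 1) :=
      Continuous.rpow_const (by fun_prop) fun _ => Or.inr (by linarith)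
    have hup : ∫ t in a..x, f t ^ (N - 1) ≤ f x ^ N / (N * k) := by
      have h := intervalIntegral.integral_mono_on_of_le_Ioo hax.le hiax
        (hcont.intervalIntegrable a x) fun t ht => Real.rpow_le_rpow
          (hpos t ⟨ht.1, ht.2.trans hxm.2⟩).le (hline t ht) (by linarith : 0 ≤ N - 1)
      rw [integral_affine_rpow hN hk0.ne'] at h
      refine h.trans ?_
      have := Real.rpow_nonneg hla N
      gcongr
      simpa using this
    have hlow : (f y ^ N - f x ^ N) / (N * k) ≤ ∫ t in x..y, f t ^ (N - 1) := by
      have h := intervalIntegral.integral_mono_on hxy.le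
        (hcont.intervalIntegrable x y) hixy fun t ht => Real.rpow_le_rpow
          (by have := mul_nonneg hk0.le (sub_nonneg.2 ht.1); linarith)
          (hf.secant_le hxm hym ht.1 ht.2 hxy) (by linarith : 0 ≤ N - 1)
      rw [integral_affine_rpow hN hk0.ne', hky] at h
      simpa using h
    have hpq : 0 ≤ f y ^ N - f x ^ N :=
      sub_nonneg.2 (Real.rpow_le_rpow hp.le hlt.le hN0.le)
    have h1 := mul_le_mul_of_nonneg_left hup hpq
    have h2 := mul_le_mul_of_nonneg_left hlow hpN.le
    have h3 : (f y ^ N - f x ^ N) * (f x ^ N / (N * k)) =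
      f x ^ N * ((f y ^ N - f x ^ N) / (N * k)) := by ring
    linarith

/-- A nonnegative concave function on an open interval vanishing at one point vanishes
identically. -/
lemma ConcaveOn.eq_zero_of_nonneg_of_eq_zero {a b x : ℝ} {f : ℝ → ℝ}
    (hf : ConcaveOn ℝ (Set.Ioo a b) f) (h0 : ∀ t ∈ Set.Ioo a b, 0 ≤ f t)
    (hx : x ∈ Set.Ioo a b) (hfx : f x = 0) : ∀ t ∈ Set.Ioo a b, f t = 0 := by
  intro t ht
  refine le_antisymm ?_ (h0 t ht)
  rcases lt_trichotomy t x with h | rfl | h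
  · obtain ⟨z, hz⟩ := exists_between hx.2
    have hzm : z ∈ Set.Ioo a b := ⟨hx.1.trans hz.1, hz.2⟩
    have := hf.le_secant_of_lt ht hzm h hz.1
    have h2 : 0 ≤ f z / (z - x) := div_nonneg (h0 z hzm) (by linarith [hz.1])
    rw [hfx, sub_zero] at this
    nlinarith
  · exact hfx.le
  · obtain ⟨z, hz⟩ := exists_between hx.1
    have hzm : z ∈ Set.Ioo a b := ⟨hz.1, hz.2.trans hx.2⟩
    have := hf.slope_anti_adjacent hzm ht hz.2 h
    have h2 : (f x - f z) / (x - z) ≤ 0 :=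
      div_nonpos_of_nonpos_of_nonneg (by linarith [h0 z hzm]) (by linarith [hz.2])
    have h3 := this.trans h2
    rw [div_le_iff₀ (by linarith)] at h3
    linarith

/-- The `1/N`-th power of the primitive of `f ^ (N - 1)` is concave when `f` is positive
and concave. -/
lemma concaveOn_integral_rpow {N a b : ℝ} {f : ℝ → ℝ} (hN : 1 < N)
    (hf : ConcaveOn ℝ (Set.Ioo a b) f) (hpos : ∀ t ∈ Set.Ioo a b, 0 < f t)
    (hint : IntervalIntegrable (fun t => f t ^ (N - 1)) volume a b)
    (hderiv : ∀ x ∈ Set.Ioo a b,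
      HasDerivAt (fun x => ∫ t in a..x, f t ^ (N - 1)) (f x ^ (N - 1)) x)
    (hFpos : ∀ x ∈ Set.Ioo a b, 0 < ∫ t in a..x, f t ^ (N - 1)) :
    ConcaveOn ℝ (Set.Ioo a b) fun x => (∫ t in a..x, f t ^ (N - 1)) ^ (1 / N) := by
  have hN0 : 0 < N := by linarith
  have hH : ∀ x ∈ Set.Ioo a b, HasDerivAt (fun x => (∫ t in a..x, f t ^ (N - 1)) ^ (1 / N))
      (f x ^ (N - 1) * (1 / N) * (∫ t in a..x, f t ^ (N - 1)) ^ (1 / N - 1)) x := fun x hx =>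
    (hderiv x hx).rpow_const (Or.inl (hFpos x hx).ne')
  refine AntitoneOn.concaveOn_of_deriv (convex_Ioo a b)
    (fun x hx => (hH x hx).continuousAt.continuousWithinAt) ?_ ?_
  · rw [interior_Ioo]
    exact fun x hx => (hH x hx).differentiableAt.differentiableWithinAt
  rw [interior_Ioo]
  intro x hx y hy hxy
  rcases hxy.eq_or_lt with rfl | hxy
  · exact le_rfl
  rw [(hH x hx).deriv, (hH y hy).deriv]
  have key := rpow_mul_integral_rpow_le hN hf hpos hint hx.1 hxy hy.2
  have hF := hFpos x hx
  have hG := hFpos y hy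
  have hp := hpos x hx
  have hq := hpos y hy
  set F := ∫ t in a..x, f t ^ (N - 1)
  set G := ∫ t in a..y, f t ^ (N - 1)
  have h1 := Real.rpow_le_rpow (by positivity) key
    (div_nonneg (by linarith) hN0.le : 0 ≤ (N - 1) / N)
  rw [Real.mul_rpow (by positivity) hF.le, Real.mul_rpow (by positivity) hG.le,
    ← Real.rpow_mul hq.le, ← Real.rpow_mul hp.le, mul_div_cancel₀ _ hN0.ne'] at h1
  have he : 1 / N - 1 = -((N - 1) / N) := by
    field_simp
    ring
  rw [he, Real.rpow_neg hF.le, Real.rpow_neg hG.le]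
  have hF' : 0 < F ^ ((N - 1) / N) := by positivity
  have hG' : 0 < G ^ ((N - 1) / N) := by positivity
  rw [← div_eq_mul_inv, ← div_eq_mul_inv, div_le_div_iff₀ hG' hF']
  calc _ = 1 / N * (f y ^ (N - 1) * F ^ ((N - 1) / N)) := by ring
    _ ≤ 1 / N * (f x ^ (N - 1) * G ^ ((N - 1) / N)) := by gcongr
    _ = _ := by ring

/-- A concave function differentiable at `c` lies below its tangent line there. -/
lemma ConcaveOn.le_tangent {s : Set ℝ} {f : ℝ → ℝ} {c m x : ℝ} (hf : ConcaveOn ℝ s f)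
    (hc : c ∈ s) (hx : x ∈ s) (hm : HasDerivAt f m c) : f x ≤ f c + m * (x - c) := by
  rcases lt_trichotomy x c with h | rfl | h
  · have := hf.le_slope_of_hasDerivAt hx hc h hm
    rw [slope_def_field, le_div_iff₀ (by linarith)] at this
    linarith
  · simp
  · have := hf.slope_le_of_hasDerivAt hc hx h hm
    rw [slope_def_field, div_le_iff₀ (by linarith)] at this
    linarith

/-- The lower bound for the mass to the left of the barycenter. -/
lemma grunbaum_left (N a b : ℝ) (w : ℝ → ℝ)
    (hN : 1 < N) (ha : a < 0) (hb : 0 < b)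
    (hw : ∀ x ∈ Set.Ioo a b, 0 ≤ w x)
    (hint : IntervalIntegrable w volume a b)
    (hconc : ConcaveOn ℝ (Set.Ioo a b) (fun x => w x ^ (1 / (N - 1))))
    (hmass : ∫ x in a..b, w x = 1)
    (hbar : ∫ x in a..b, x * w x = 0) :
    (N / (N + 1)) ^ N ≤ ∫ x in a..0, w x := by
  have hab : a < b := ha.trans hb
  have hN0 : 0 < N := by linarith
  have hN1 : 0 < N - 1 := by linarith
  have hwf : ∀ x ∈ Set.Ioo a b, (w x ^ (1 / (N - 1))) ^ (N - 1) = w x := fun x hx => by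
    rw [← Real.rpow_mul (hw x hx), one_div_mul_cancel hN1.ne', Real.rpow_one]
  set f : ℝ → ℝ := fun x => w x ^ (1 / (N - 1)) with hf
  have hf0 : ∀ x ∈ Set.Ioo a b, 0 ≤ f x := fun x hx => Real.rpow_nonneg (hw x hx) _
  have hpos : ∀ x ∈ Set.Ioo a b, 0 < f x := by
    intro x hx
    refine (hf0 x hx).lt_of_ne fun h => ?_
    have hz := hconc.eq_zero_of_nonneg_of_eq_zero hf0 hx h.symm
    have : ∫ x in a..b, w x = ∫ x in a..b, (0 : ℝ) := by
      rw [intervalIntegral.integral_of_le hab.le, intervalIntegral.integral_of_le hab.le,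
        integral_Ioc_eq_integral_Ioo, integral_Ioc_eq_integral_Ioo]
      refine setIntegral_congr_fun measurableSet_Ioo fun t ht => ?_
      rw [← hwf t ht]
      change f t ^ (N - 1) = 0
      rw [hz t ht, Real.zero_rpow hN1.ne']
    rw [hmass] at this
    simp at this
  have hfc : ContinuousOn f (Set.Ioo a b) := hconc.continuousOn isOpen_Ioo
  have hwc : ContinuousOn (fun x => f x ^ (N - 1)) (Set.Ioo a b) :=
    hfc.rpow_const fun x hx => Or.inr hN1.le
  have hcongr : ∀ u ∈ Set.Icc a b, ∀ v ∈ Set.Icc a b, u ≤ v → ∀ g : ℝ → ℝ,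
      ∫ x in u..v, g x * f x ^ (N - 1) = ∫ x in u..v, g x * w x := by
    intro u hu v hv huv g
    rw [intervalIntegral.integral_of_le huv, intervalIntegral.integral_of_le huv,
      integral_Ioc_eq_integral_Ioo, integral_Ioc_eq_integral_Ioo]
    refine setIntegral_congr_fun measurableSet_Ioo fun t ht => ?_
    simp only [hf, hwf t ⟨hu.1.trans_lt ht.1, ht.2.trans_le hv.2⟩]
  have hi : IntervalIntegrable (fun x => f x ^ (N - 1)) volume a b := by
    refine (intervalIntegrable_iff_integrableOn_Ioo_of_le hab.le).2 ?_
    exact ((intervalIntegrable_iff_integrableOn_Ioo_of_le hab.le).1 hint).congr_fun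
      (fun t ht => (hwf t ht).symm) measurableSet_Ioo
  have hFcont : ContinuousOn (fun x => ∫ t in a..x, f t ^ (N - 1)) (Set.Icc a b) := by
    rw [← Set.uIcc_of_le hab.le]
    exact intervalIntegral.continuousOn_primitive_interval' hi Set.left_mem_uIcc
  have hsub : ∀ x ∈ Set.Ioo a b, IntervalIntegrable (fun x => f x ^ (N - 1)) volume a x :=
    fun x hx => hi.mono_set (by
      rw [Set.uIcc_of_le hab.le, Set.uIcc_of_le hx.1.le]
      exact Set.Icc_subset_Icc le_rfl hx.2.le)
  have hderiv : ∀ x ∈ Set.Ioo a b,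
      HasDerivAt (fun x => ∫ t in a..x, f t ^ (N - 1)) (f x ^ (N - 1)) x := fun x hx =>
    intervalIntegral.integral_hasDerivAt_right (hsub x hx)
      (hwc.stronglyMeasurableAtFilter isOpen_Ioo x hx) (hwc.continuousAt (isOpen_Ioo.mem_nhds hx))
  have hFpos : ∀ x ∈ Set.Ioo a b, 0 < ∫ t in a..x, f t ^ (N - 1) := fun x hx =>
    intervalIntegral.intervalIntegral_pos_of_pos_on (hsub x hx)
      (fun t ht => Real.rpow_pos_of_pos (hpos t ⟨ht.1, ht.2.trans hx.2⟩) _) hx.1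
  have h0 : (0 : ℝ) ∈ Set.Ioo a b := ⟨ha, hb⟩
  have hconcF := concaveOn_integral_rpow hN hconc hpos hi hderiv hFpos
  have hm := (hderiv 0 h0).rpow_const (p := 1 / N) (Or.inl (hFpos 0 h0).ne')
  have hmassF : ∫ t in a..b, f t ^ (N - 1) = 1 := by
    simpa [hmass] using hcongr a ⟨le_rfl, hab.le⟩ b ⟨hab.le, le_rfl⟩ hab.le fun _ => 1
  have hbarF : ∫ t in a..b, t * f t ^ (N - 1) = 0 :=
    (hcongr a ⟨le_rfl, hab.le⟩ b ⟨hab.le, le_rfl⟩ hab.le fun t => t).trans hbar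
  have hleft : ∫ t in a..0, f t ^ (N - 1) = ∫ t in a..0, w t := by
    simpa using hcongr a ⟨le_rfl, hab.le⟩ 0 ⟨ha.le, hb.le⟩ ha.le fun _ => 1
  rw [← hleft]
  have hφ := hFpos 0 h0
  set F : ℝ → ℝ := fun x => ∫ t in a..x, f t ^ (N - 1) with hF
  change (N / (N + 1)) ^ N ≤ F 0
  change 0 < F 0 at hφ
  set m := f 0 ^ (N - 1) * (1 / N) * F 0 ^ (1 / N - 1)
  have hFN : ContinuousOn (fun x => F x ^ (1 / N)) (Set.Icc a b) :=
    hFcont.rpow_const fun _ _ => Or.inr (by positivity)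
  have hprod : IntervalIntegrable (fun x => F x ^ (1 / N) * f x ^ (N - 1)) volume a b :=
    hi.continuousOn_mul (by rwa [Set.uIcc_of_le hab.le])
  have htot : ∫ x in a..b, F x ^ (1 / N) * f x ^ (N - 1) = N / (N + 1) := by
    rw [intervalIntegral.integral_eq_sub_of_hasDerivAt_of_le hab.le
      (f := fun x => N / (N + 1) * F x ^ (1 / N + 1)) _ _ hprod]
    · have hFa : F a = 0 := by simp [hF]
      have hFb : F b = 1 := hmassF
      rw [hFa, hFb, Real.one_rpow, Real.zero_rpow (by positivity)]
      ring
    · exact continuousOn_const.mul (hFcont.rpow_const fun _ _ => Or.inr (by positivity))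
    · intro x hx
      refine (((hderiv x hx).rpow_const (p := 1 / N + 1)
        (Or.inl (hFpos x hx).ne')).const_mul (N / (N + 1))).congr_deriv ?_
      rw [add_sub_cancel_right]
      field_simp
      ring
  have hi' : IntervalIntegrable (fun x => x * f x ^ (N - 1)) volume a b :=
    hi.continuousOn_mul continuousOn_id
  have hle : N / (N + 1) ≤ F 0 ^ (1 / N) := by
    rw [← htot]
    calc ∫ x in a..b, F x ^ (1 / N) * f x ^ (N - 1)
        ≤ ∫ x in a..b, (F 0 ^ (1 / N) * f x ^ (N - 1) + m * (x * f x ^ (N - 1))) := by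
          refine intervalIntegral.integral_mono_on_of_le_Ioo hab.le hprod
            ((hi.const_mul _).add (hi'.const_mul _)) fun x hx => ?_
          have h := hconcF.le_tangent h0 hx hm
          have := mul_le_mul_of_nonneg_right h (Real.rpow_pos_of_pos (hpos x hx) (N - 1)).le
          refine this.trans_eq ?_
          ring
      _ = F 0 ^ (1 / N) := by
          rw [intervalIntegral.integral_add (hi.const_mul _) (hi'.const_mul _),
            intervalIntegral.integral_const_mul, intervalIntegral.integral_const_mul,
            hmassF, hbarF]
          ring
  calc (N / (N + 1)) ^ N ≤ (F 0 ^ (1 / N)) ^ N :=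
        Real.rpow_le_rpow (by positivity) hle hN0.le
    _ = F 0 := by rw [← Real.rpow_mul hφ.le, one_div_mul_cancel hN0.ne', Real.rpow_one]

/-- One-dimensional Grünbaum inequality for CD(0,N) densities, N ∈ (1,∞):
a probability density `w` on `(a,b)` with barycenter `0` such that `w^{1/(N-1)}`
is concave satisfies `∫_a^0 w ≥ (N/(N+1))^N` and `∫_0^b w ≥ (N/(N+1))^N`. -/
theorem grunbaum_one_dim_pos (N a b : ℝ) (w : ℝ → ℝ)
    (hN : 1 < N) (ha : a < 0) (hb : 0 < b)
    (hw : ∀ x ∈ Set.Ioo a b, 0 ≤ w x)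
    (hint : IntegrableOn w (Set.Ioo a b))
    (hconc : ConcaveOn ℝ (Set.Ioo a b) (fun x => w x ^ (1 / (N - 1))))
    (hmass : ∫ x in Set.Ioo a b, w x = 1)
    (hbar : ∫ x in Set.Ioo a b, x * w x = 0) :
    (N / (N + 1)) ^ N ≤ ∫ x in Set.Ioo a 0, w x ∧
      (N / (N + 1)) ^ N ≤ ∫ x in Set.Ioo (0 : ℝ) b, w x := by
  have hab : a ≤ b := (ha.trans hb).le
  have hint' := (intervalIntegrable_iff_integrableOn_Ioo_of_le hab).2 hint
  simp only [← integral_Ioc_eq_integral_Ioo, ← intervalIntegral.integral_of_le hab,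
    ← intervalIntegral.integral_of_le ha.le, ← intervalIntegral.integral_of_le hb.le]
    at hmass hbar ⊢
  refine ⟨grunbaum_left N a b w hN ha hb hw hint' hconc hmass hbar, ?_⟩
  have hmem : ∀ x ∈ Set.Ioo (-b) (-a), -x ∈ Set.Ioo a b := fun x hx =>
    ⟨by linarith [hx.2], by linarith [hx.1]⟩
  have h := grunbaum_left N (-b) (-a) (fun x => w (-x)) hN (by linarith) (by linarith)
    (fun x hx => hw _ (hmem x hx)) ?_ ?_ ?_ ?_
  · simpa [intervalIntegral.integral_comp_neg] using h
  · exact ((IntervalIntegrable.iff_comp_neg (by simp)).1 hint').symm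
  · refine ⟨convex_Ioo _ _, fun x hx y hy s t hs ht hst => ?_⟩
    have h := hconc.2 (hmem x hx) (hmem y hy) hs ht hst
    have he : s • -x + t • -y = -(s • x + t • y) := by
      simp only [smul_eq_mul]
      ring
    rwa [he] at h
  · simpa [intervalIntegral.integral_comp_neg] using hmass
  · have h := intervalIntegral.integral_comp_neg (a := -b) (b := -a) fun x => x * w x
    simpa [hbar] using h
end

section
/- Let N > 1 be a real number, let a < b be real numbers, and let w : (a,b) → (0,∞) be an integrable function such that x ↦ w(x)^{1/(N-1)} is concave on (a,b). Define R(x) := ∫_a^x w(s) ds for x ∈ (a,b). Then the function x ↦ R(x)^{1/N} is concave on (a,b). -/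
open MeasureTheory

/-- Chordal form of concavity, without divisions. -/
theorem ConcaveOn.chord_le {s : Set ℝ} {f : ℝ → ℝ} (hf : ConcaveOn ℝ s f) {x y z : ℝ}
    (hx : x ∈ s) (hz : z ∈ s) (hxy : x ≤ y) (hyz : y ≤ z) :
    (z - y) * f x + (y - x) * f z ≤ (z - x) * f y := by
  rcases (hxy.trans hyz).eq_or_lt with rfl | hlt
  · obtain rfl : x = y := le_antisymm hxy hyz
    simp
  have hpos : 0 < z - x := sub_pos.2 hlt
  have h := hf.2 hx hz (div_nonneg (sub_nonneg.2 hyz) hpos.le)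
    (div_nonneg (sub_nonneg.2 hxy) hpos.le)
    (by rw [← add_div, sub_add_sub_cancel, div_self hpos.ne'])
  have e : ((z - y) / (z - x)) • x + ((y - x) / (z - x)) • z = y := by
    simp only [smul_eq_mul]
    field_simp
    ring
  rw [e] at h
  simp only [smul_eq_mul] at h
  calc (z - y) * f x + (y - x) * f z
      = (z - x) * ((z - y) / (z - x) * f x + (y - x) / (z - x) * f z) := by field_simp
    _ ≤ (z - x) * f y := mul_le_mul_of_nonneg_left h hpos.le

/-- The dilation that sends `x` to `y` with ratio `f y / f x` moves points to the right. -/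
theorem ConcaveOn.le_sub_div_mul_sub {I : Set ℝ} {f : ℝ → ℝ} (hf : ConcaveOn ℝ I f)
    (hpos : ∀ x ∈ I, 0 < f x) {s x y : ℝ} (hs : s ∈ I) (hx : x ∈ I) (hy : y ∈ I)
    (hsx : s ≤ x) (hxy : x ≤ y) : s ≤ y - f y / f x * (x - s) := by
  have h := hf.chord_le hs hy hsx hxy
  have hfx := hpos x hx
  have hle : f y / f x * (x - s) ≤ y - s := by
    rw [div_mul_eq_mul_div, div_le_iff₀ hfx]
    nlinarith [mul_nonneg (sub_nonneg.2 hxy) (hpos s hs).le]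
  linarith

/-- A positive concave function grows at least by the ratio of the dilation that sends
`x` to `y` with ratio `f y / f x`. -/
theorem ConcaveOn.div_mul_le_apply_dilation {I : Set ℝ} {f : ℝ → ℝ} (hf : ConcaveOn ℝ I f)
    (hpos : ∀ x ∈ I, 0 < f x) {s x y : ℝ} (hs : s ∈ I) (hx : x ∈ I) (hy : y ∈ I)
    (hsx : s < x) (hxy : x ≤ y) :
    f y / f x * f s ≤ f (y - f y / f x * (x - s)) := by
  have hfx := hpos x hx
  have hc : 0 < f y / f x := div_pos (hpos y hy) hfx
  have hcx : f y / f x * f x = f y := div_mul_cancel₀ _ hfx.ne'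
  have h₁ := hf.chord_le hs hy hsx.le hxy
  have h₂ := hf.chord_le hs hy (hf.le_sub_div_mul_sub hpos hs hx hy hsx.le hxy)
    (sub_le_self y (mul_nonneg hc.le (sub_nonneg.2 hsx.le)))
  generalize f y / f x = c at *
  have hys : 0 < y - s := by linarith
  refine le_of_mul_le_mul_left ?_ hys
  have h₃ := mul_le_mul_of_nonneg_left h₁ hc.le
  have h₄ : c * ((y - s) * f x) = (y - s) * f y := by rw [← hcx]; ring
  rw [h₄] at h₃
  linarith

/-- If `w^{1/p}` is concave and positive on `(a,b)`, then `R / w^{(p+1)/p}` is monotone, where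
`R x = ∫_a^x w`. -/
theorem rpow_mul_integral_le_integral_of_concaveOn {a b p : ℝ} {w f : ℝ → ℝ} (hp : 0 < p)
    (hf : ConcaveOn ℝ (Set.Ioo a b) f) (hpos : ∀ x ∈ Set.Ioo a b, 0 < f x)
    (hw : ∀ x ∈ Set.Ioo a b, w x = f x ^ p) (hint : IntegrableOn w (Set.Ioo a b))
    {x y : ℝ} (hx : x ∈ Set.Ioo a b) (hy : y ∈ Set.Ioo a b) (hxy : x ≤ y) :
    (f y / f x) ^ (p + 1) * ∫ s in a..x, w s ≤ ∫ s in a..y, w s := by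
  have hc : 0 < f y / f x := div_pos (hpos y hy) (hpos x hx)
  have hint' : ∀ u ∈ Set.Icc a b, ∀ v ∈ Set.Icc a b, IntervalIntegrable w volume u v := by
    intro u hu v hv
    have h : IntervalIntegrable w volume a b :=
      (intervalIntegrable_iff_integrableOn_Ioo_of_le (hx.1.trans hx.2).le).2 hint
    refine h.mono_set ?_
    rw [Set.uIcc_of_le (hx.1.trans hx.2).le]
    exact Set.uIcc_subset_Icc hu hv
  have hmem : ∀ s ∈ Set.Ioo a x, s ∈ Set.Ioo a b := fun s hs => ⟨hs.1, hs.2.trans hx.2⟩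
  have hleft : ∀ s ∈ Set.Ioo a x, s ≤ y - f y / f x * (x - s) := fun s hs =>
    hf.le_sub_div_mul_sub hpos (hmem s hs) hx hy hs.2.le hxy
  have hright : ∀ s ∈ Set.Ioo a x, y - f y / f x * (x - s) < b := fun s hs => by
    have := mul_pos hc (sub_pos.2 hs.2)
    linarith [hy.2]
  have hdil : ∀ s ∈ Set.Ioo a x, (f y / f x) ^ p * w s ≤ w (y - f y / f x * (x - s)) := by
    intro s hs
    rw [hw s (hmem s hs), hw _ ⟨hs.1.trans_le (hleft s hs), hright s hs⟩,
      ← Real.mul_rpow hc.le (hpos s (hmem s hs)).le]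
    exact Real.rpow_le_rpow (mul_pos hc (hpos s (hmem s hs))).le
      (hf.div_mul_le_apply_dilation hpos (hmem s hs) hx hy hs.2 hxy) hp.le
  have hA : a ≤ y - f y / f x * (x - a) := by
    have hcl : a ∈ closure (Set.Ioo a x) := by
      rw [closure_Ioo hx.1.ne]
      exact Set.left_mem_Icc.2 hx.1.le
    exact le_on_closure (f := fun s => s) (g := fun s => y - f y / f x * (x - s)) hleft
      (by fun_prop) (by fun_prop) hcl
  generalize f y / f x = c at *
  have hAy : y - c * (x - a) ≤ y := sub_le_self y (mul_nonneg hc.le (sub_nonneg.2 hx.1.le))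
  have hyI : y ∈ Set.Icc a b := Set.Ioo_subset_Icc_self hy
  have haI : a ∈ Set.Icc a b := Set.left_mem_Icc.2 (hx.1.trans hx.2).le
  have hAI : y - c * (x - a) ∈ Set.Icc a b := ⟨hA, hAy.trans hy.2.le⟩
  have hform : ∀ s, y - c * (x - s) = c * s + (y - c * x) := fun s => by ring
  have hsub : c * ∫ s in a..x, w (y - c * (x - s)) = ∫ s in (y - c * (x - a))..y, w s := by
    simp_rw [hform]
    rw [intervalIntegral.mul_integral_comp_mul_add]
    congr 1
    ring
  have hcomp : IntervalIntegrable (fun s => w (y - c * (x - s))) volume a x := by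
    have h := ((hint' _ hAI y hyI).comp_add_right (y - c * x)).comp_mul_left (c := c)
    simp_rw [hform]
    convert h using 1
    · field_simp
      ring
    · field_simp
      ring
  have hmono : c ^ p * ∫ s in a..x, w s ≤ ∫ s in a..x, w (y - c * (x - s)) := by
    rw [← intervalIntegral.integral_const_mul]
    exact intervalIntegral.integral_mono_on_of_le_Ioo hx.1.le
      ((hint' a haI x (Set.Ioo_subset_Icc_self hx)).const_mul _) hcomp hdil
  have hnonneg : 0 ≤ ∫ s in a..(y - c * (x - a)), w s := by
    rw [intervalIntegral.integral_of_le hA]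
    refine setIntegral_nonneg measurableSet_Ioc fun s hs => ?_
    have hsI : s ∈ Set.Ioo a b := ⟨hs.1, (hs.2.trans hAy).trans_lt hy.2⟩
    rw [hw s hsI]
    exact (Real.rpow_pos_of_pos (hpos s hsI) p).le
  calc c ^ (p + 1) * ∫ s in a..x, w s = c * (c ^ p * ∫ s in a..x, w s) := by
        rw [Real.rpow_add_one hc.ne']; ring
    _ ≤ c * ∫ s in a..x, w (y - c * (x - s)) := mul_le_mul_of_nonneg_left hmono hc.le
    _ = ∫ s in (y - c * (x - a))..y, w s := hsub
    _ ≤ ∫ s in a..y, w s := by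
        rw [← intervalIntegral.integral_add_adjacent_intervals (hint' a haI _ hAI)
          (hint' _ hAI y hyI)]
        linarith

/-- If `w : (a,b) → (0,∞)` is integrable and `w^{1/(N-1)}` is concave for some `N > 1`,
then the cumulative distribution function `R(x) = ∫_a^x w` satisfies that `R^{1/N}`
is concave on `(a,b)`. -/
theorem cdf_rpow_concave (N a b : ℝ) (w : ℝ → ℝ)
    (hN : 1 < N) (hab : a < b)
    (hw : ∀ x ∈ Set.Ioo a b, 0 < w x)
    (hint : IntegrableOn w (Set.Ioo a b))
    (hconc : ConcaveOn ℝ (Set.Ioo a b) (fun x => w x ^ (1 / (N - 1)))) :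
    ConcaveOn ℝ (Set.Ioo a b) (fun x => (∫ s in Set.Ioo a x, w s) ^ (1 / N)) := by
  have hN₁ : 0 < N - 1 := sub_pos.2 hN
  have hN₀ : 0 < N := by linarith
  have hpos : ∀ x ∈ Set.Ioo a b, 0 < w x ^ (1 / (N - 1)) := fun x hx =>
    Real.rpow_pos_of_pos (hw x hx) _
  have hpow : ∀ x ∈ Set.Ioo a b, w x = (w x ^ (1 / (N - 1))) ^ (N - 1) := fun x hx => by
    rw [← Real.rpow_mul (hw x hx).le, one_div_mul_cancel hN₁.ne', Real.rpow_one]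
  have hcont : ContinuousOn w (Set.Ioo a b) :=
    ((hconc.continuousOn isOpen_Ioo).rpow_const fun _ _ => Or.inr hN₁.le).congr hpow
  have hii : ∀ x ∈ Set.Ioo a b, IntervalIntegrable w volume a x := fun x hx =>
    (intervalIntegrable_iff_integrableOn_Ioo_of_le hx.1.le).2
      (hint.mono_set (Set.Ioo_subset_Ioo_right hx.2.le))
  have hRpos : ∀ x ∈ Set.Ioo a b, 0 < ∫ s in a..x, w s := fun x hx =>
    intervalIntegral.intervalIntegral_pos_of_pos_on (hii x hx)
      (fun s hs => hw s ⟨hs.1, hs.2.trans hx.2⟩) hx.1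
  have hderiv : ∀ x ∈ Set.Ioo a b, HasDerivAt (fun x => (∫ s in a..x, w s) ^ (1 / N))
      (w x * (1 / N) * (∫ s in a..x, w s) ^ (1 / N - 1)) x := fun x hx =>
    (intervalIntegral.integral_hasDerivAt_right (hii x hx)
      (hcont.stronglyMeasurableAtFilter isOpen_Ioo x hx)
      (hcont.continuousAt (isOpen_Ioo.mem_nhds hx))).rpow_const (Or.inl (hRpos x hx).ne')
  have hmain : ConcaveOn ℝ (Set.Ioo a b) (fun x => (∫ s in a..x, w s) ^ (1 / N)) := by
    refine AntitoneOn.concaveOn_of_deriv (convex_Ioo a b)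
      (fun x hx => (hderiv x hx).continuousAt.continuousWithinAt) ?_ ?_
    · rw [interior_Ioo]
      exact fun x hx => (hderiv x hx).differentiableAt.differentiableWithinAt
    · rw [interior_Ioo]
      intro x hx y hy hxy
      rw [(hderiv x hx).deriv, (hderiv y hy).deriv]
      have hle := rpow_mul_integral_le_integral_of_concaveOn hN₁ hconc hpos hpow hint hx hy hxy
      have hc := div_pos (hpos y hy) (hpos x hx)
      have hwy : w y = (w y ^ (1 / (N - 1)) / w x ^ (1 / (N - 1))) ^ (N - 1) * w x := by
        rw [Real.div_rpow (hpos y hy).le (hpos x hx).le, ← hpow x hx, ← hpow y hy,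
          div_mul_cancel₀ _ (hw x hx).ne']
      rw [sub_add_cancel] at hle
      generalize w y ^ (1 / (N - 1)) / w x ^ (1 / (N - 1)) = c at *
      have hexp : 1 / N - 1 ≤ 0 := by
        rw [sub_nonpos, div_le_one hN₀]
        exact hN.le
      have h := Real.rpow_le_rpow_of_nonpos
        (mul_pos (Real.rpow_pos_of_pos hc N) (hRpos x hx)) hle hexp
      rw [Real.mul_rpow (Real.rpow_pos_of_pos hc N).le (hRpos x hx).le, ← Real.rpow_mul hc.le,
        show N * (1 / N - 1) = -(N - 1) by field_simp; ring, Real.rpow_neg hc.le] at h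
      have hcN := Real.rpow_pos_of_pos hc (N - 1)
      calc w y * (1 / N) * (∫ s in a..y, w s) ^ (1 / N - 1)
          ≤ w y * (1 / N) * ((c ^ (N - 1))⁻¹ * (∫ s in a..x, w s) ^ (1 / N - 1)) :=
            mul_le_mul_of_nonneg_left h (mul_pos (hw y hy) (by positivity)).le
        _ = w x * (1 / N) * (∫ s in a..x, w s) ^ (1 / N - 1) := by
            rw [hwy]
            field_simp
  refine hmain.congr fun x hx => ?_
  simp only [intervalIntegral.integral_of_le hx.1.le, integral_Ioc_eq_integral_Ioo]
end

section
/- Let N > 1 be a real number, let a < 0 < b be real numbers, and let w : (a,b) → [0,∞) be an integrable function such that x ↦ w(x)^{1/(N-1)} is concave on (a,b), ∫_a^b w(x) dx = 1, and ∫_a^b x·w(x) dx = 0. If equality ∫_a^0 w(x) dx = (N/(N+1))^N holds, then there exists c > 0 such that a = −N/c, b = 1/c, and w(x) = c·(N/(N+1))^N·(1 + (c/N)·x)^{N-1} for all x ∈ (a,b). -/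
open MeasureTheory

/-- The chord inequality for concave functions with denominators cleared. -/
lemma ConcaveOn.mul_sub_le_mul_sub {s : Set ℝ} {g : ℝ → ℝ} (hg : ConcaveOn ℝ s g)
    {x y z : ℝ} (hx : x ∈ s) (hz : z ∈ s) (hxy : x < y) (hyz : y < z) :
    (g z - g y) * (y - x) ≤ (g y - g x) * (z - y) :=
  (div_le_div_iff₀ (sub_pos.2 hyz) (sub_pos.2 hxy)).1 (hg.slope_anti_adjacent hx hz hxy hyz)

/-- A nonnegative concave function on an open interval that does not vanish identically is
positive. -/
lemma ConcaveOn.pos_of_nonneg_of_ne_zero {a b : ℝ} {f : ℝ → ℝ}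
    (hf : ConcaveOn ℝ (Set.Ioo a b) f) (h0 : ∀ x ∈ Set.Ioo a b, 0 ≤ f x)
    {x : ℝ} (hx : x ∈ Set.Ioo a b) (hfx : f x ≠ 0) {y : ℝ} (hy : y ∈ Set.Ioo a b) :
    0 < f y := by
  have hxpos : 0 < f x := lt_of_le_of_ne (h0 x hx) hfx.symm
  rcases lt_trichotomy x y with h | rfl | h
  · obtain ⟨z, hyz, hzb⟩ := exists_between hy.2
    have hz : z ∈ Set.Ioo a b := ⟨hy.1.trans hyz, hzb⟩
    have := hf.mul_sub_le_mul_sub hx hz h hyz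
    by_contra! hle
    nlinarith [h0 z hz, h0 y hy, mul_pos hxpos (sub_pos.2 hyz),
      mul_nonneg (h0 z hz) (sub_pos.2 h).le]
  · exact hxpos
  · obtain ⟨z, haz, hzy⟩ := exists_between hy.1
    have hz : z ∈ Set.Ioo a b := ⟨haz, hzy.trans hy.2⟩
    have := hf.mul_sub_le_mul_sub hz hx hzy h
    by_contra! hle
    nlinarith [h0 z hz, h0 y hy, mul_pos hxpos (sub_pos.2 hzy),
      mul_nonneg (h0 z hz) (sub_pos.2 h).le]

/-- A concave function on an interval changes sign at most once to the left of a zero. -/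
lemma ConcaveOn.exists_sign_change_left {a b : ℝ} {g : ℝ → ℝ}
    (hg : ConcaveOn ℝ (Set.Ioo a b) g) {z : ℝ} (hz : z ∈ Set.Ioo a b) (hgz : g z = 0) :
    ∃ y, a ≤ y ∧ y ≤ z ∧ (∀ x ∈ Set.Ioo a y, g x ≤ 0) ∧ ∀ x ∈ Set.Ioo y z, 0 ≤ g x := by
  let S := {x | a < x ∧ x ≤ z ∧ 0 ≤ g x}
  have hzS : z ∈ S := ⟨hz.1, le_rfl, hgz.ge⟩
  have hS : BddBelow S := ⟨a, fun x hx => hx.1.le⟩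
  have hyz : sInf S ≤ z := csInf_le hS hzS
  refine ⟨sInf S, le_csInf ⟨z, hzS⟩ fun x hx => hx.1.le, hyz, fun x hx => ?_, fun x hx => ?_⟩
  · by_contra! h
    exact hx.2.not_ge (csInf_le hS ⟨hx.1, hx.2.le.trans hyz, h.le⟩)
  · obtain ⟨t, ht, htx⟩ := exists_lt_of_csInf_lt ⟨z, hzS⟩ hx.1
    have := hg.mul_sub_le_mul_sub ⟨ht.1, htx.trans (hx.2.trans hz.2)⟩ hz htx hx.2
    have hgt : 0 ≤ g t := ht.2.2
    rw [hgz] at this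
    by_contra! hneg
    nlinarith [mul_nonneg hgt (sub_pos.2 hx.2).le, mul_pos (neg_pos.2 hneg) (sub_pos.2 htx),
      mul_pos (neg_pos.2 hneg) (sub_pos.2 hx.2)]

lemma integral_cone_density {N c A x y : ℝ} (hN : 1 < N) (hc : c ≠ 0) :
    ∫ t in x..y, A * (1 + c / N * t) ^ (N - 1) =
      A / c * (1 + c / N * y) ^ N - A / c * (1 + c / N * x) ^ N := by
  have hN0 : N ≠ 0 := by positivity
  refine intervalIntegral.integral_eq_sub_of_hasDerivAt
    (f := fun t => A / c * (1 + c / N * t) ^ N) (fun t _ => ?_) ?_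
  · have h1 : HasDerivAt (fun t : ℝ => 1 + c / N * t) (c / N) t := by
      simpa using ((hasDerivAt_id t).const_mul (c / N)).const_add 1
    refine ((h1.rpow_const (p := N) (Or.inr hN.le)).const_mul (A / c)).congr_deriv ?_
    field_simp
  · refine Continuous.intervalIntegrable ?_ _ _
    exact continuous_const.mul
      (Continuous.rpow_const (by fun_prop) fun _ => Or.inr (by linarith))

lemma integral_mul_cone_density {N c A x y : ℝ} (hN : 1 < N) (hc : 0 < c)
    (hx : 0 ≤ 1 + c / N * x) (hxy : x ≤ y) :
    ∫ t in x..y, t * (A * (1 + c / N * t) ^ (N - 1)) =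
      A * (N / c) ^ 2 * ((1 + c / N * y) ^ (N + 1) / (N + 1) - (1 + c / N * y) ^ N / N) -
      A * (N / c) ^ 2 * ((1 + c / N * x) ^ (N + 1) / (N + 1) - (1 + c / N * x) ^ N / N) := by
  have hN0 : 0 < N := by linarith
  refine intervalIntegral.integral_eq_sub_of_hasDerivAt
    (f := fun t => A * (N / c) ^ 2 *
      ((1 + c / N * t) ^ (N + 1) / (N + 1) - (1 + c / N * t) ^ N / N)) (fun t ht => ?_) ?_
  · rw [Set.uIcc_of_le hxy] at ht
    have ht0 : 0 ≤ 1 + c / N * t := by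
      have : c / N * x ≤ c / N * t := mul_le_mul_of_nonneg_left ht.1 (by positivity)
      linarith
    have h1 : HasDerivAt (fun t : ℝ => 1 + c / N * t) (c / N) t := by
      simpa using ((hasDerivAt_id t).const_mul (c / N)).const_add 1
    have h2 := (h1.rpow_const (p := N) (Or.inr hN.le)).div_const N
    have h3 := (h1.rpow_const (p := N + 1) (Or.inr (by linarith))).div_const (N + 1)
    refine ((h3.sub h2).const_mul (A * (N / c) ^ 2)).congr_deriv ?_
    have h4 : (1 + c / N * t) ^ (N + 1 - 1) = (1 + c / N * t) ^ (N - 1) * (1 + c / N * t) := by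
      rw [← Real.rpow_add_one' ht0 (by simpa using hN0.ne')]
      congr 1
      ring
    rw [h4]
    have : N + 1 ≠ 0 := by positivity
    field_simp
    ring
  · refine Continuous.intervalIntegrable ?_ _ _
    exact continuous_id.mul (continuous_const.mul
      (Continuous.rpow_const (by fun_prop) fun _ => Or.inr (by linarith)))

/-- If `D` has vanishing mass, vanishing first moment and vanishing mass on `(-∞, 0)`, and has
the sign of `x - y` on `(-∞, 0)` and of `x - v` on `[0, ∞)`, then `D` vanishes almost
everywhere. -/
lemma ae_eq_zero_of_sign_changes {D : ℝ → ℝ} {y v : ℝ} (hD : Integrable D)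
    (hxD : Integrable fun x => x * D x) (h0 : ∫ x, D x = 0) (h1 : ∫ x, x * D x = 0)
    (hleft : ∫ x in Set.Iio 0, D x = 0)
    (hy : ∀ x < 0, 0 ≤ (x - y) * D x) (hv : ∀ x, 0 ≤ x → 0 ≤ (x - v) * D x) :
    D =ᵐ[volume] 0 := by
  have hint : Integrable fun x =>
      x * D x - v * D x + (v - y) * (Set.Iio 0).indicator D x :=
    (hxD.sub (hD.const_mul v)).add ((hD.indicator measurableSet_Iio).const_mul _)
  have hnonneg : ∀ x, 0 ≤ x * D x - v * D x + (v - y) * (Set.Iio 0).indicator D x := by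
    intro x
    by_cases hx : x < 0
    · rw [Set.indicator_of_mem (by exact hx)]
      linarith [hy x hx]
    · rw [Set.indicator_of_notMem (by exact hx)]
      linarith [hv x (not_lt.1 hx)]
  have hzero : ∫ x, (x * D x - v * D x + (v - y) * (Set.Iio 0).indicator D x) = 0 := by
    rw [integral_add (f := fun x => x * D x - v * D x) (hxD.sub (hD.const_mul v))
      ((hD.indicator measurableSet_Iio).const_mul _),
      integral_sub hxD (hD.const_mul v), integral_const_mul, integral_const_mul,
      integral_indicator measurableSet_Iio, h0, h1, hleft]
    ring
  have hae := (integral_eq_zero_iff_of_nonneg hnonneg hint).1 hzero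
  filter_upwards [hae, Measure.ae_ne volume y, Measure.ae_ne volume v] with x hx hxy hxv
  simp only [Pi.zero_apply] at hx ⊢
  by_cases h : x < 0
  · rw [Set.indicator_of_mem (by exact h)] at hx
    have : (x - y) * D x = 0 := by linarith
    exact (mul_eq_zero.1 this).resolve_left (sub_ne_zero.2 hxy)
  · rw [Set.indicator_of_notMem (by exact h)] at hx
    have : (x - v) * D x = 0 := by linarith
    exact (mul_eq_zero.1 this).resolve_left (sub_ne_zero.2 hxv)

/-- If `w` is positive on `(a, b)` and its extension by zero agrees almost everywhere with a
function extended by zero from `(u, v)`, then `(a, b)` is contained in `(u, v)`. -/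
lemma endpoints_le_of_indicator_ae_eq {a b u v : ℝ} {w h : ℝ → ℝ} (hab : a < b)
    (hw : ∀ x ∈ Set.Ioo a b, 0 < w x)
    (hae : (Set.Ioo a b).indicator w =ᵐ[volume] (Set.Ioo u v).indicator h) :
    u ≤ a ∧ b ≤ v := by
  have key : ∀ p q, p < q → Set.Ioo p q ⊆ Set.Ioo a b →
      ¬ Disjoint (Set.Ioo p q) (Set.Ioo u v) := by
    intro p q hpq hsub hdisj
    have hnull : volume (Set.Ioo p q) = 0 := by
      refine measure_mono_null (fun x hx => ?_) (ae_iff.1 hae)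
      simp only [Set.mem_ofPred_eq]
      rw [Set.indicator_of_mem (hsub hx),
        Set.indicator_of_notMem (Set.disjoint_left.1 hdisj hx)]
      exact (hw x (hsub hx)).ne'
    simp [hpq.not_ge] at hnull
  constructor
  · by_contra! h
    refine key a (min u b) (lt_min h hab) (Set.Ioo_subset_Ioo_right (min_le_right _ _)) ?_
    exact Set.disjoint_left.2 fun x hx hx' => lt_asymm (hx.2.trans_le (min_le_left _ _)) hx'.1
  · by_contra! h
    refine key (max v a) b (max_lt h hab) (Set.Ioo_subset_Ioo_left (le_max_right _ _)) ?_
    exact Set.disjoint_left.2 fun x hx hx' => lt_asymm ((le_max_left _ _).trans_lt hx.1) hx'.2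

/-- Rigidity in the one-dimensional Grünbaum inequality for `N ∈ (1,∞)`: equality
`∫_a^0 w = (N/(N+1))^N` forces the cone-type model density. -/
theorem grunbaum_one_dim_pos_rigidity (N a b : ℝ) (w : ℝ → ℝ)
    (hN : 1 < N) (ha : a < 0) (hb : 0 < b)
    (hw : ∀ x ∈ Set.Ioo a b, 0 ≤ w x)
    (hint : IntegrableOn w (Set.Ioo a b))
    (hconc : ConcaveOn ℝ (Set.Ioo a b) (fun x => w x ^ (1 / (N - 1))))
    (hmass : ∫ x in Set.Ioo a b, w x = 1)
    (hbar : ∫ x in Set.Ioo a b, x * w x = 0)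
    (heq : ∫ x in Set.Ioo a 0, w x = (N / (N + 1)) ^ N) :
    ∃ c > 0, a = -N / c ∧ b = 1 / c ∧
      ∀ x ∈ Set.Ioo a b,
        w x = c * (N / (N + 1)) ^ N * (1 + (c / N) * x) ^ (N - 1) := by
  have hN0 : 0 < N := by linarith
  have hm : 0 < N - 1 := by linarith
  have h0mem : (0 : ℝ) ∈ Set.Ioo a b := ⟨ha, hb⟩
  set f : ℝ → ℝ := fun x => w x ^ (1 / (N - 1)) with hf
  have hf0 : ∀ x ∈ Set.Ioo a b, 0 ≤ f x := fun x hx => Real.rpow_nonneg (hw x hx) _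
  have hwf : ∀ x ∈ Set.Ioo a b, w x = f x ^ (N - 1) := fun x hx => by
    rw [hf, ← Real.rpow_mul (hw x hx), one_div_mul_cancel hm.ne', Real.rpow_one]
  have hfpos : ∀ x ∈ Set.Ioo a b, 0 < f x := by
    obtain ⟨x, hx, hfx⟩ : ∃ x ∈ Set.Ioo a b, f x ≠ 0 := by
      by_contra! h
      rw [setIntegral_congr_fun (g := fun _ => (0 : ℝ)) measurableSet_Ioo fun x hx => by
        rw [hwf x hx, h x hx, Real.zero_rpow hm.ne']] at hmass
      simp at hmass
    exact fun y hy => hconc.pos_of_nonneg_of_ne_zero hf0 hx hfx hy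
  have hwpos : ∀ x ∈ Set.Ioo a b, 0 < w x := fun x hx => by
    rw [hwf x hx]
    exact Real.rpow_pos_of_pos (hfpos x hx) _
  set P : ℝ := (N / (N + 1)) ^ N with hP
  have hPpos : 0 < P := by positivity
  obtain ⟨c, hc⟩ : ∃ c, c = w 0 / P := ⟨_, rfl⟩
  have hcpos : 0 < c := hc ▸ div_pos (hwpos 0 h0mem) hPpos
  have hcP : c * P = w 0 := by rw [hc]; field_simp
  let h : ℝ → ℝ := fun x => c * P * (1 + c / N * x) ^ (N - 1)
  let k : ℝ → ℝ := fun x => f 0 * (1 + c / N * x)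
  set u := -N / c with hu
  set v := 1 / c with hv
  have hu0 : u < 0 := div_neg_of_neg_of_pos (by linarith) hcpos
  have hv0 : 0 < v := by positivity
  have huv : u < v := hu0.trans hv0
  have htu : 1 + c / N * u = 0 := by rw [hu]; field_simp; ring
  have htv : 1 + c / N * v = (N / (N + 1))⁻¹ := by rw [hv]; field_simp
  have htpos : ∀ x, u < x → 0 < 1 + c / N * x := fun x hx => by
    rw [← htu]
    gcongr
  have hk : ∀ x, u ≤ x → k x ^ (N - 1) = h x := fun x hx => by
    have : 0 ≤ 1 + c / N * x := by
      rw [← htu]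
      gcongr
    simp only [k, h]
    rw [Real.mul_rpow (hf0 0 h0mem) this, ← hwf 0 h0mem, hcP]
  have hhpos : ∀ x ∈ Set.Ioo u v, 0 < h x := fun x hx =>
    mul_pos (by positivity) (Real.rpow_pos_of_pos (htpos x hx.1) _)
  have hhcont : Continuous h := continuous_const.mul
    (Continuous.rpow_const (by fun_prop) fun _ => Or.inr hm.le)
  have hhint : IntegrableOn h (Set.Ioo u v) :=
    (hhcont.integrableOn_Icc (a := u) (b := v)).mono_set Set.Ioo_subset_Icc_self
  have hxhint : IntegrableOn (fun x => x * h x) (Set.Ioo u v) :=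
    ((continuous_id.mul hhcont).integrableOn_Icc (a := u) (b := v)).mono_set
      Set.Ioo_subset_Icc_self
  have hxwint : IntegrableOn (fun x => x * w x) (Set.Ioo a b) := by
    refine Integrable.bdd_mul (c := max |a| |b|) hint
      continuous_id.aestronglyMeasurable ?_
    filter_upwards [ae_restrict_mem measurableSet_Ioo] with x hx
    exact abs_le_max_abs_abs hx.1.le hx.2.le
  have hhleft : ∫ x in Set.Ioo u 0, h x = P := by
    rw [← integral_Ioc_eq_integral_Ioo, ← intervalIntegral.integral_of_le hu0.le,
      integral_cone_density hN hcpos.ne', htu, Real.zero_rpow hN0.ne']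
    simp
    field_simp
  have hhmass : ∫ x in Set.Ioo u v, h x = 1 := by
    rw [← integral_Ioc_eq_integral_Ioo, ← intervalIntegral.integral_of_le huv.le,
      integral_cone_density hN hcpos.ne', htu, htv, Real.zero_rpow hN0.ne',
      Real.inv_rpow (by positivity), ← hP]
    field_simp
    simp
  have hhbar : ∫ x in Set.Ioo u v, x * h x = 0 := by
    rw [← integral_Ioc_eq_integral_Ioo, ← intervalIntegral.integral_of_le huv.le,
      integral_mul_cone_density hN hcpos htu.ge huv.le, htu, htv, Real.zero_rpow hN0.ne',
      Real.zero_rpow (by positivity), Real.rpow_add_one (by positivity)]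
    field_simp
    simp
  set W := (Set.Ioo a b).indicator w with hW
  set H := (Set.Ioo u v).indicator h with hH
  have hWint : Integrable W := hint.integrable_indicator measurableSet_Ioo
  have hHint : Integrable H := hhint.integrable_indicator measurableSet_Ioo
  have hxW : (fun x => x * W x) = (Set.Ioo a b).indicator fun x => x * w x := by
    ext x
    simp [hW, Set.indicator_apply]
  have hxH : (fun x => x * H x) = (Set.Ioo u v).indicator fun x => x * h x := by
    ext x
    simp [hH, Set.indicator_apply]
  have hxWint : Integrable fun x => x * W x :=
    hxW ▸ hxwint.integrable_indicator measurableSet_Ioo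
  have hxHint : Integrable fun x => x * H x :=
    hxH ▸ hxhint.integrable_indicator measurableSet_Ioo
  have hDint : Integrable fun x => W x - H x := hWint.sub hHint
  have hxDeq : (fun x => x * (W x - H x)) = fun x => x * W x - x * H x := by
    ext x
    ring
  have hD0 : ∫ x, (W x - H x) = 0 := by
    rw [integral_sub hWint hHint, hW, hH, integral_indicator measurableSet_Ioo,
      integral_indicator measurableSet_Ioo, hmass, hhmass, sub_self]
  have hD1 : ∫ x, x * (W x - H x) = 0 := by
    rw [hxDeq, integral_sub hxWint hxHint, hxW, hxH, integral_indicator measurableSet_Ioo,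
      integral_indicator measurableSet_Ioo, hbar, hhbar, sub_self]
  have hinter : ∀ p q : ℝ, 0 < q → Set.Iio 0 ∩ Set.Ioo p q = Set.Ioo p 0 := fun p q hq => by
    ext x
    simp only [Set.mem_inter_iff, Set.mem_Iio, Set.mem_Ioo]
    exact ⟨fun hx => ⟨hx.2.1, hx.1⟩, fun hx => ⟨hx.2, hx.1, hx.2.trans hq⟩⟩
  have hDleft : ∫ x in Set.Iio 0, (W x - H x) = 0 := by
    rw [integral_sub hWint.integrableOn hHint.integrableOn, hW, hH,
      setIntegral_indicator measurableSet_Ioo, setIntegral_indicator measurableSet_Ioo,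
      hinter a b hb, hinter u v hv0, heq, hhleft, sub_self]
  have hWnonneg : ∀ x, 0 ≤ W x := fun x => Set.indicator_nonneg hw x
  have hHnonneg : ∀ x, 0 ≤ H x := fun x =>
    Set.indicator_nonneg (fun x hx => (hhpos x hx).le) x
  have hkpos : ∀ x, 0 < k x → u < x := fun x hx => by
    have hpos : 0 < 1 + c / N * x := pos_of_mul_pos_right hx (hf0 0 h0mem)
    rw [← htu] at hpos
    by_contra! hle
    have : c / N * x ≤ c / N * u := mul_le_mul_of_nonneg_left hle (by positivity)
    linarith
  have hWle : ∀ x ∈ Set.Ioo a b, x < v → f x - k x ≤ 0 → W x ≤ H x := fun x hx hxv hg => by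
    have hux : u < x := hkpos x (by linarith [hfpos x hx])
    rw [hW, hH, Set.indicator_of_mem hx, Set.indicator_of_mem (Set.mem_Ioo.2 ⟨hux, hxv⟩),
      hwf x hx, ← hk x hux.le]
    exact Real.rpow_le_rpow (hf0 x hx) (by linarith) hm.le
  have hleW : ∀ x ∈ Set.Ioo a b, 0 ≤ f x - k x → H x ≤ W x := fun x hx hg => by
    by_cases hxuv : x ∈ Set.Ioo u v
    · rw [hW, hH, Set.indicator_of_mem hx, Set.indicator_of_mem hxuv, hwf x hx,
        ← hk x hxuv.1.le]
      refine Real.rpow_le_rpow ?_ (by linarith) hm.le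
      exact mul_nonneg (hf0 0 h0mem) (htpos x hxuv.1).le
    · rw [hH, Set.indicator_of_notMem hxuv]
      exact hWnonneg x
  have hgconc : ConcaveOn ℝ (Set.Ioo a b) fun x => f x - k x := by
    refine hconc.sub ⟨convex_Ioo a b, fun x _ y _ s t _ _ hst => le_of_eq ?_⟩
    simp only [k, smul_eq_mul]
    linear_combination (-f 0) * hst
  have hg0 : f 0 - k 0 = 0 := by simp [k]
  have hgright : ∀ x ∈ Set.Ioo 0 b, f x - k x ≤ 0 := by
    intro z hz
    by_contra! hgz
    have hneg : ∀ x ∈ Set.Ioo a 0, f x - k x < 0 := fun x hx => by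
      have := hgconc.mul_sub_le_mul_sub ⟨hx.1, hx.2.trans hb⟩ ⟨ha.trans hz.1, hz.2⟩ hx.2 hz.1
      simp only [hg0] at this
      by_contra! hge
      nlinarith [mul_pos hgz (neg_pos.2 hx.2), mul_nonneg hge hz.1.le]
    have hae : (fun x => H x - W x) =ᵐ[volume.restrict (Set.Iio 0)] 0 := by
      refine (setIntegral_eq_zero_iff_of_nonneg_ae ?_ ?_).1 ?_
      · filter_upwards [ae_restrict_mem measurableSet_Iio] with x hx
        simp only [Pi.zero_apply, sub_nonneg]
        by_cases hxa : a < x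
        · exact hWle x ⟨hxa, lt_trans hx hb⟩ (lt_trans hx hv0) (hneg x ⟨hxa, hx⟩).le
        · rw [hW, Set.indicator_of_notMem fun hx' => hxa hx'.1]
          exact hHnonneg x
      · exact (hHint.sub hWint).integrableOn
      · simpa only [← integral_neg, neg_sub, neg_zero] using congrArg Neg.neg hDleft
    have hnull : volume (Set.Ioo a 0) = 0 := by
      refine measure_mono_null (fun x hx => ?_)
        (ae_iff.1 ((ae_restrict_iff' measurableSet_Iio).1 hae))
      have hxab : x ∈ Set.Ioo a b := ⟨hx.1, hx.2.trans hb⟩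
      have hux : u < x := hkpos x (by linarith [hfpos x hxab, hneg x hx])
      simp only [Set.mem_ofPred_eq, Classical.not_imp]
      refine ⟨hx.2, ?_⟩
      rw [hW, hH, Set.indicator_of_mem hxab,
        Set.indicator_of_mem (Set.mem_Ioo.2 ⟨hux, hx.2.trans hv0⟩),
        hwf x hxab, ← hk x hux.le]
      exact (sub_pos.2 (Real.rpow_lt_rpow (hf0 x hxab) (by linarith [hneg x hx]) hm)).ne'
    simp [ha.not_ge] at hnull
  obtain ⟨y, hay, hy0, hyleft, hyright⟩ := hgconc.exists_sign_change_left h0mem hg0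
  have hDae : (fun x => W x - H x) =ᵐ[volume] 0 := by
    refine ae_eq_zero_of_sign_changes (y := y) (v := v) hDint
      (hxDeq ▸ hxWint.sub hxHint) hD0 hD1 hDleft (fun x hx => ?_) fun x hx => ?_
    · rcases lt_trichotomy x y with hxy | rfl | hxy
      · refine mul_nonneg_of_nonpos_of_nonpos (by linarith) (sub_nonpos.2 ?_)
        by_cases hxa : a < x
        · exact hWle x ⟨hxa, hx.trans hb⟩ (hx.trans hv0) (hyleft x ⟨hxa, hxy⟩)
        · rw [hW, Set.indicator_of_notMem fun hx' => hxa hx'.1]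
          exact hHnonneg x
      · simp
      · exact mul_nonneg (by linarith) (sub_nonneg.2
          (hleW x ⟨hay.trans_lt hxy, hx.trans hb⟩ (hyright x ⟨hxy, hx⟩)))
    · by_cases hxv : x < v
      · refine mul_nonneg_of_nonpos_of_nonpos (by linarith) (sub_nonpos.2 ?_)
        by_cases hxb : x < b
        · refine hWle x ⟨ha.trans_le hx, hxb⟩ hxv ?_
          rcases hx.eq_or_lt with rfl | hx
          · exact hg0.le
          · exact hgright x ⟨hx, hxb⟩
        · rw [hW, Set.indicator_of_notMem fun hx' => hxb hx'.2]
          exact hHnonneg x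
      · refine mul_nonneg (by linarith) ?_
        rw [hH, Set.indicator_of_notMem fun hx' => hxv hx'.2, sub_zero]
        exact hWnonneg x
  have hWH : W =ᵐ[volume] H := by
    filter_upwards [hDae] with x hx
    exact sub_eq_zero.1 hx
  obtain ⟨hua, hbv⟩ := endpoints_le_of_indicator_ae_eq (ha.trans hb) hwpos hWH
  obtain ⟨hau, hvb⟩ := endpoints_le_of_indicator_ae_eq huv hhpos hWH.symm
  have hau' : a = u := le_antisymm hau hua
  have hbv' : b = v := le_antisymm hbv hvb
  refine ⟨c, hcpos, hau', hbv', ?_⟩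
  have hwcont : ContinuousOn w (Set.Ioo a b) :=
    ((hconc.continuousOn isOpen_Ioo).rpow_const fun _ _ => Or.inr hm.le).congr hwf
  refine Measure.eqOn_open_of_ae_eq (μ := volume) (g := h) ?_ isOpen_Ioo hwcont
    hhcont.continuousOn
  filter_upwards [ae_restrict_of_ae hWH, ae_restrict_mem measurableSet_Ioo] with x hx hxab
  rwa [hW, hH, ← hau', ← hbv', Set.indicator_of_mem hxab, Set.indicator_of_mem hxab] at hx
end

section
/- Let N < −1 be a real number, let −∞ ≤ a < 0 < b ≤ ∞, and let w : (a,b) → (0,∞) be an integrable function such that x ↦ w(x)^{1/(N-1)} is convex on (a,b), ∫_a^b w(x) dx = 1, and ∫_a^b x·w(x) dx = 0. Then ∫_a^0 w(x) dx ≥ (N/(N+1))^N and ∫_0^b w(x) dx ≥ (N/(N+1))^N. -/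
open MeasureTheory

/-- The set of real numbers lying strictly between two extended real numbers. -/
def erealIoo (a b : EReal) : Set ℝ := {x : ℝ | a < (x : EReal) ∧ (x : EReal) < b}

open Set

/-- The mass that a function `u` places to the right of `x`. -/
noncomputable def tailIntegral (u : ℝ → ℝ) (x : ℝ) : ℝ := ∫ t in Ioi x, u t

theorem intervalIntegral_add_tailIntegral {u : ℝ → ℝ} (hu : Integrable u) (x y : ℝ) :
    (∫ t in x..y, u t) + tailIntegral u y = tailIntegral u x :=
  intervalIntegral.integral_interval_add_Ioi hu.integrableOn hu.integrableOn

theorem hasDerivAt_tailIntegral {u : ℝ → ℝ} (hu : Integrable u) {x : ℝ}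
    (hx : ContinuousAt u x) : HasDerivAt (tailIntegral u) (-u x) x := by
  have h : HasDerivAt (fun y => tailIntegral u 0 - ∫ t in (0 : ℝ)..y, u t) (-u x) x :=
    (intervalIntegral.integral_hasDerivAt_right hu.intervalIntegrable
      hu.aestronglyMeasurable.stronglyMeasurableAtFilter hx).const_sub _
  refine h.congr_of_eventuallyEq (Filter.Eventually.of_forall fun y => ?_)
  have := intervalIntegral_add_tailIntegral hu 0 y
  simp only
  linarith

theorem ConvexOn.sub_mul_le {S : Set ℝ} {h : ℝ → ℝ} (hh : ConvexOn ℝ S h) {x y z : ℝ}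
    (hx : x ∈ S) (hz : z ∈ S) (hxy : x < y) (hyz : y < z) :
    (z - x) * h y ≤ (z - y) * h x + (y - x) * h z := by
  have := hh.slope_mono_adjacent hx hz hxy hyz
  rw [div_le_div_iff₀ (by linarith) (by linarith)] at this
  linarith

theorem integrableOn_and_integral_affine_rpow {N k x : ℝ} (hN : N < 0) (hk : 0 < k)
    (hx : 0 < 1 + k * x) :
    IntegrableOn (fun t => (1 + k * t) ^ (N - 1)) (Ioi x) ∧
      ∫ t in Ioi x, (1 + k * t) ^ (N - 1) = (1 + k * x) ^ N / (-N * k) := by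
  have hpos : ∀ t ∈ Ici x, 0 < 1 + k * t := fun t ht => by
    have : k * x ≤ k * t := mul_le_mul_of_nonneg_left ht hk.le
    linarith
  have hNk : N * k ≠ 0 := by nlinarith
  have hderiv : ∀ t ∈ Ici x,
      HasDerivAt (fun t => (1 + k * t) ^ N / (N * k)) ((1 + k * t) ^ (N - 1)) t := fun t ht => by
    have h1 : HasDerivAt (fun t : ℝ => 1 + k * t) k t := by
      simpa using ((hasDerivAt_id t).const_mul k).const_add 1
    refine ((h1.rpow_const (p := N) (Or.inl (hpos t ht).ne')).div_const (N * k)).congr_deriv ?_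
    rw [div_eq_iff hNk]
    ring
  have hnonneg : ∀ t ∈ Ioi x, 0 ≤ (1 + k * t) ^ (N - 1) := fun t ht =>
    Real.rpow_nonneg (hpos t (mem_Ici_of_Ioi ht)).le _
  have hlim : Filter.Tendsto (fun t => (1 + k * t) ^ N / (N * k)) Filter.atTop (nhds 0) := by
    have h2 : Filter.Tendsto (fun t : ℝ => 1 + k * t) Filter.atTop Filter.atTop :=
      Filter.tendsto_atTop_add_const_left _ _ (Filter.tendsto_id.const_mul_atTop hk)
    simpa using ((tendsto_rpow_neg_atTop (neg_pos.2 hN)).comp h2).div_const (N * k)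
  refine ⟨integrableOn_Ioi_deriv_of_nonneg' hderiv hnonneg hlim, ?_⟩
  rw [integral_Ioi_of_hasDerivAt_of_nonneg' hderiv hnonneg hlim]
  field_simp
  ring

/-- `u` is an integrable density supported on the open set `S`, where it is the power
`h ^ (N - 1)` of a positive convex function `h`. -/
structure IsConvexPowerDensity (N : ℝ) (S : Set ℝ) (h u : ℝ → ℝ) : Prop where
  isOpen : IsOpen S
  zero_mem : (0 : ℝ) ∈ S
  convexOn : ConvexOn ℝ S h
  pos : ∀ x ∈ S, 0 < h x
  eq_rpow : ∀ x ∈ S, u x = h x ^ (N - 1)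
  eq_zero : ∀ x ∉ S, u x = 0
  integrable : Integrable u

namespace IsConvexPowerDensity

variable {N : ℝ} {S : Set ℝ} {h u : ℝ → ℝ}

theorem comp_neg (H : IsConvexPowerDensity N S h u) :
    IsConvexPowerDensity N (-S) (fun x => h (-x)) (fun x => u (-x)) where
  isOpen := H.isOpen.neg
  zero_mem := by simpa using H.zero_mem
  convexOn := H.convexOn.comp_linearMap (-LinearMap.id)
  pos x hx := H.pos _ hx
  eq_rpow x hx := H.eq_rpow _ hx
  eq_zero x hx := H.eq_zero _ hx
  integrable := H.integrable.comp_neg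

theorem density_pos (H : IsConvexPowerDensity N S h u) {x : ℝ} (hx : x ∈ S) : 0 < u x := by
  rw [H.eq_rpow x hx]
  exact Real.rpow_pos_of_pos (H.pos x hx) _

theorem density_nonneg (H : IsConvexPowerDensity N S h u) (x : ℝ) : 0 ≤ u x := by
  by_cases hx : x ∈ S
  · exact (H.density_pos hx).le
  · rw [H.eq_zero x hx]

theorem tailIntegral_nonneg (H : IsConvexPowerDensity N S h u) (x : ℝ) :
    0 ≤ tailIntegral u x :=
  integral_nonneg H.density_nonneg

theorem continuousAt (H : IsConvexPowerDensity N S h u) {x : ℝ} (hx : x ∈ S) :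
    ContinuousAt u x := by
  have hS := H.isOpen.mem_nhds hx
  have h1 : ContinuousAt h x := (H.convexOn.continuousOn H.isOpen).continuousAt hS
  refine (h1.rpow_const (p := N - 1) (Or.inl (H.pos x hx).ne')).congr ?_
  filter_upwards [hS] with y hy using (H.eq_rpow y hy).symm

theorem strictAntiOn_tailIntegral (H : IsConvexPowerDensity N S h u) :
    StrictAntiOn (tailIntegral u) S := by
  intro x hx y hy hxy
  have h1 := intervalIntegral_add_tailIntegral H.integrable x y
  have h2 : 0 < ∫ t in x..y, u t :=
    intervalIntegral.intervalIntegral_pos_of_pos_on H.integrable.intervalIntegrable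
      (fun t ht => H.density_pos (H.convexOn.1.ordConnected.out hx hy (Ioo_subset_Icc_self ht))) hxy
  linarith

theorem tailIntegral_pos (H : IsConvexPowerDensity N S h u) {x : ℝ} (hx : x ∈ S) :
    0 < tailIntegral u x := by
  obtain ⟨y, hy, hxy⟩ := ((eventually_nhdsWithin_of_eventually_nhds
    (H.isOpen.mem_nhds hx)).and (self_mem_nhdsWithin (s := Ioi x))).exists
  exact (H.tailIntegral_nonneg y).trans_lt (H.strictAntiOn_tailIntegral hx hy hxy)

/-- The tail mass is uniformly distributed on `(0, 1)`, so its powers are integrable. -/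
theorem integrableOn_and_integral_tailIntegral_rpow_le (H : IsConvexPowerDensity N S h u)
    (hmass : ∫ x, u x = 1) {q : ℝ} (hq : -1 < q) :
    IntegrableOn (fun x => u x * tailIntegral u x ^ q) S ∧
      ∫ x in S, u x * tailIntegral u x ^ q ≤ 1 / (q + 1) := by
  have hder : ∀ x ∈ S, HasDerivWithinAt (tailIntegral u) (-u x) S x := fun x hx =>
    (hasDerivAt_tailIntegral H.integrable (H.continuousAt hx)).hasDerivWithinAt
  have hinj := H.strictAntiOn_tailIntegral.injOn
  have hmeas := H.isOpen.measurableSet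
  have heq : (fun x => |(-u x)| • tailIntegral u x ^ q) = fun x => u x * tailIntegral u x ^ q := by
    ext x
    rw [abs_neg, abs_of_nonneg (H.density_nonneg x), smul_eq_mul]
  have himage : tailIntegral u '' S ⊆ Ioc 0 1 := by
    rintro _ ⟨x, hx, rfl⟩
    exact ⟨H.tailIntegral_pos hx, hmass ▸ setIntegral_le_integral H.integrable
      (Filter.Eventually.of_forall H.density_nonneg)⟩
  have hint : IntegrableOn (fun y : ℝ => y ^ q) (Ioc 0 1) :=
    (intervalIntegrable_iff_integrableOn_Ioc_of_le zero_le_one).1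
      (intervalIntegral.intervalIntegrable_rpow' hq)
  constructor
  · rw [← heq, ← integrableOn_image_iff_integrableOn_abs_deriv_smul hmeas hder hinj
      (fun y => y ^ q)]
    exact hint.mono_set himage
  · rw [← heq, ← integral_image_eq_integral_abs_deriv_smul hmeas hder hinj (fun y => y ^ q)]
    have h1 : ∫ y in Ioc (0 : ℝ) 1, y ^ q = 1 / (q + 1) := by
      rw [← intervalIntegral.integral_of_le zero_le_one, integral_rpow (Or.inl hq), Real.one_rpow,
        Real.zero_rpow (by linarith), sub_zero]
    rw [← h1]
    refine setIntegral_mono_set hint ?_ himage.eventuallyLE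
    filter_upwards [ae_restrict_mem measurableSet_Ioc] with y hy
    exact Real.rpow_nonneg hy.1.le _

theorem tailIntegral_le_of_affine_le (H : IsConvexPowerDensity N S h u) (hN : N < 0)
    {c k x : ℝ} (hc : 0 < c) (hk : 0 < k) (hx : 0 < 1 + k * x)
    (hle : ∀ t ∈ S, x < t → c * (1 + k * t) ≤ h t) :
    tailIntegral u x ≤ c ^ (N - 1) * ((1 + k * x) ^ N / (-N * k)) := by
  obtain ⟨hint, heq⟩ := integrableOn_and_integral_affine_rpow hN hk hx
  rw [← heq, ← integral_const_mul]
  refine setIntegral_mono_on H.integrable.integrableOn (hint.const_mul _) measurableSet_Ioi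
    fun t ht => ?_
  have hpos : 0 < 1 + k * t := by
    have : k * x ≤ k * t := mul_le_mul_of_nonneg_left (le_of_lt ht) hk.le
    linarith
  by_cases htS : t ∈ S
  · rw [H.eq_rpow t htS, ← Real.mul_rpow hc.le hpos.le]
    exact Real.rpow_le_rpow_of_nonpos (by positivity) (hle t htS ht) (by linarith)
  · rw [H.eq_zero t htS]
    positivity

/-- The tail of `u` is dominated by the tail of the power of an affine function which has the same
density at `0` and the same mass to the right of `0` as `u`. -/
theorem tailIntegral_le (H : IsConvexPowerDensity N S h u) (hN : N < 0) {k x : ℝ}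
    (hk : k = u 0 / (-N * tailIntegral u 0)) (hxS : x ∈ S) (hx : 0 < 1 + k * x) :
    tailIntegral u x ≤ tailIntegral u 0 * (1 + k * x) ^ N := by
  have hT := H.tailIntegral_pos H.zero_mem
  have hu0 := H.density_pos H.zero_mem
  have hh0 := H.pos 0 H.zero_mem
  have hN' : 0 < -N := by linarith
  have hkpos : 0 < k := by rw [hk]; positivity
  have hscale : h 0 ^ (N - 1) / (-N * k) = tailIntegral u 0 := by
    rw [← H.eq_rpow 0 H.zero_mem, hk]
    have := hN.ne
    field_simp
  have hcompare : ∀ y, 0 < 1 + k * y → (∀ t ∈ S, y < t → h 0 * (1 + k * t) ≤ h t) →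
      tailIntegral u y ≤ tailIntegral u 0 * (1 + k * y) ^ N := fun y hy hle => by
    have := H.tailIntegral_le_of_affine_le hN hh0 hkpos hy hle
    rwa [mul_div_left_comm, mul_comm, hscale] at this
  have hmodel : ∀ y, 0 < 1 + k * y → IntegrableOn (fun t => h 0 ^ (N - 1) * (1 + k * t) ^ (N - 1))
      (Ioi y) ∧ ∫ t in Ioi y, h 0 ^ (N - 1) * (1 + k * t) ^ (N - 1) =
        tailIntegral u 0 * (1 + k * y) ^ N := fun y hy => by
    obtain ⟨hi, he⟩ := integrableOn_and_integral_affine_rpow hN hkpos hy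
    refine ⟨hi.const_mul _, ?_⟩
    rw [integral_const_mul, he, mul_div_left_comm, mul_comm, hscale]
  have hsplit := intervalIntegral.integral_interval_add_Ioi (hmodel 0 (by simp)).1 (hmodel x hx).1
  rw [(hmodel 0 (by simp)).2, (hmodel x hx).2] at hsplit
  simp only [mul_zero, add_zero, Real.one_rpow, mul_one] at hsplit
  have husplit := intervalIntegral_add_tailIntegral H.integrable 0 x
  have hord := H.convexOn.1.ordConnected
  rcases lt_trichotomy x 0 with hx0 | rfl | hx0
  · -- to the left of `0`, the convex function lies above the affine one
    have habove : ∀ t ∈ S, t < 0 → h 0 * (1 + k * t) ≤ h t := by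
      intro t htS ht
      by_contra! hlt
      obtain ⟨k', hk'⟩ : ∃ k', h 0 * (1 + k' * t) = h t := by
        refine ⟨(h t / h 0 - 1) / t, ?_⟩
        have := ht.ne
        field_simp
        ring
      have hkk' : k < k' := by
        rw [← hk', mul_lt_mul_iff_right₀ hh0] at hlt
        nlinarith
      have hle := H.tailIntegral_le_of_affine_le hN hh0 (hkpos.trans hkk') (x := 0) (by simp)
        fun s hsS hs => by
          have := H.convexOn.sub_mul_le htS hsS ht hs
          rw [← hk'] at this
          have ht' : 0 < -t := by linarith
          refine le_of_mul_le_mul_left ?_ ht'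
          linarith
      have hlt' : h 0 ^ (N - 1) / (-N * k') < h 0 ^ (N - 1) / (-N * k) := by
        have := Real.rpow_pos_of_pos hh0 (N - 1)
        gcongr
      simp only [mul_zero, add_zero, Real.one_rpow, mul_one_div] at hle
      linarith
    have hI : ∫ t in x..0, u t ≤ ∫ t in x..0, h 0 ^ (N - 1) * (1 + k * t) ^ (N - 1) := by
      refine intervalIntegral.integral_mono_on hx0.le H.integrable.intervalIntegrable
        ((intervalIntegrable_iff_integrableOn_Ioc_of_le hx0.le).2
          ((hmodel x hx).1.mono_set Ioc_subset_Ioi_self)) fun t ht => ?_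
      have htS := hord.out hxS H.zero_mem ht
      have hpos : 0 < 1 + k * t := by nlinarith [ht.1]
      rw [H.eq_rpow t htS, ← Real.mul_rpow hh0.le hpos.le]
      refine Real.rpow_le_rpow_of_nonpos (by positivity) ?_ (by linarith)
      rcases ht.2.lt_or_eq with h0 | rfl
      · exact habove t htS h0
      · simp
    rw [intervalIntegral.integral_symm x 0] at hsplit husplit
    linarith
  · simp
  · by_cases hcross : h 0 * (1 + k * x) ≤ h x
    · refine hcompare x hx fun t htS ht => ?_
      have := H.convexOn.sub_mul_le H.zero_mem htS hx0 ht
      have h2 := mul_le_mul_of_nonneg_left hcross (hx0.trans ht).le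
      refine le_of_mul_le_mul_left ?_ hx0
      linarith
    · push Not at hcross
      have hI : ∫ t in (0 : ℝ)..x, h 0 ^ (N - 1) * (1 + k * t) ^ (N - 1) ≤ ∫ t in (0 : ℝ)..x, u t := by
        refine intervalIntegral.integral_mono_on hx0.le
          ((intervalIntegrable_iff_integrableOn_Ioc_of_le hx0.le).2
            ((hmodel 0 (by simp)).1.mono_set Ioc_subset_Ioi_self))
          H.integrable.intervalIntegrable fun t ht => ?_
        have htS := hord.out H.zero_mem hxS ht
        have hpos : 0 < 1 + k * t := by nlinarith [ht.1]
        rw [H.eq_rpow t htS, ← Real.mul_rpow hh0.le hpos.le]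
        refine Real.rpow_le_rpow_of_nonpos (H.pos t htS) ?_ (by linarith)
        rcases ht.1.eq_or_lt with rfl | h0
        · simp
        rcases ht.2.eq_or_lt with rfl | h1
        · exact hcross.le
        have := H.convexOn.sub_mul_le H.zero_mem hxS h0 h1
        have h2 := mul_le_mul_of_nonneg_left hcross.le h0.le
        refine le_of_mul_le_mul_left ?_ hx0
        linarith
      linarith

/-- The power `1 / N` of the tail mass has a supporting line at `0`, of positive slope. -/
theorem exists_le_tailIntegral_rpow (H : IsConvexPowerDensity N S h u) (hN : N < 0) :
    ∃ k, 0 < k ∧ ∀ x ∈ S,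
      tailIntegral u 0 ^ (1 / N) * (1 + k * x) ≤ tailIntegral u x ^ (1 / N) := by
  have hT := H.tailIntegral_pos H.zero_mem
  have hu0 := H.density_pos H.zero_mem
  have hN' : 0 < -N := by linarith
  refine ⟨u 0 / (-N * tailIntegral u 0), by positivity, fun x hx => ?_⟩
  set k := u 0 / (-N * tailIntegral u 0) with hk
  rcases le_or_gt (1 + k * x) 0 with hneg | hpos
  · exact (mul_nonpos_of_nonneg_of_nonpos (by positivity) hneg).trans
      (Real.rpow_nonneg (H.tailIntegral_nonneg x) _)
  · have h1 := Real.rpow_le_rpow_of_nonpos (H.tailIntegral_pos hx) (H.tailIntegral_le hN hk hx hpos)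
      (one_div_neg.2 hN).le
    rwa [Real.mul_rpow hT.le (by positivity), ← Real.rpow_mul hpos.le, mul_one_div_cancel hN.ne,
      Real.rpow_one] at h1

theorem integrableOn_Ioi_mul (H : IsConvexPowerDensity N S h u) (hN : N < -1)
    (hmass : ∫ x, u x = 1) : IntegrableOn (fun x => x * u x) (Ioi 0) := by
  obtain ⟨k, hk, hle⟩ := H.exists_le_tailIntegral_rpow (by linarith)
  have hT := H.tailIntegral_pos H.zero_mem
  have hq : -1 < 1 / N := by rw [lt_div_iff_of_neg (by linarith)]; linarith
  have hG := (H.integrableOn_and_integral_tailIntegral_rpow_le hmass hq).1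
  have hG' := ((integrable_indicator_iff H.isOpen.measurableSet).2 hG).div_const
    (tailIntegral u 0 ^ (1 / N) * k)
  refine hG'.integrableOn.mono' (continuous_id.aestronglyMeasurable.mul
    H.integrable.aestronglyMeasurable.restrict) ?_
  filter_upwards [ae_restrict_mem measurableSet_Ioi] with x hx
  have hx : 0 < x := hx
  have hux := H.density_nonneg x
  rw [Real.norm_of_nonneg (by positivity)]
  by_cases hxS : x ∈ S
  · have hc : 0 < tailIntegral u 0 ^ (1 / N) := by positivity
    rw [indicator_of_mem hxS, le_div_iff₀ (by positivity)]
    have h1 : tailIntegral u 0 ^ (1 / N) * (k * x) ≤ tailIntegral u x ^ (1 / N) :=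
      le_trans (by gcongr; linarith) (hle x hxS)
    linarith [mul_le_mul_of_nonneg_left h1 hux]
  · rw [indicator_of_notMem hxS, H.eq_zero x hxS]
    simp

theorem integrable_mul (H : IsConvexPowerDensity N S h u) (hN : N < -1)
    (hmass : ∫ x, u x = 1) : Integrable (fun x => x * u x) := by
  have h1 := H.integrableOn_Ioi_mul hN hmass
  have h2 := H.comp_neg.integrableOn_Ioi_mul hN (by rw [integral_neg_eq_self u volume, hmass])
  have h3 : IntegrableOn (fun x => x * u x) (Iio 0) := by
    have := (integrable_indicator_iff measurableSet_Ioi).2 h2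
    rw [← integrable_indicator_iff measurableSet_Iio]
    refine this.comp_neg.neg.congr (Filter.Eventually.of_forall fun x => ?_)
    by_cases hx : x < 0 <;> simp [indicator, hx]
  rw [← integrableOn_univ, ← Iic_union_Ioi (a := (0 : ℝ))]
  exact ((integrableOn_Iic_iff_integrableOn_Iio).2 h3).union h1

theorem rpow_le_tailIntegral_zero (H : IsConvexPowerDensity N S h u) (hN : N < -1)
    (hmass : ∫ x, u x = 1) (hbar : ∫ x, x * u x = 0) :
    (N / (N + 1)) ^ N ≤ tailIntegral u 0 := by
  obtain ⟨k, -, hle⟩ := H.exists_le_tailIntegral_rpow (by linarith)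
  have hT := H.tailIntegral_pos H.zero_mem
  have hN0 : N ≠ 0 := by linarith
  have hN1 : N + 1 ≠ 0 := by linarith
  have hq : -1 < 1 / N := by rw [lt_div_iff_of_neg (by linarith)]; linarith
  obtain ⟨hG, hGle⟩ := H.integrableOn_and_integral_tailIntegral_rpow_le hmass hq
  set c := tailIntegral u 0 ^ (1 / N) with hc
  have hlin : Integrable fun x => c * u x + c * k * (x * u x) :=
    (H.integrable.const_mul c).add ((H.integrable_mul hN hmass).const_mul _)
  have h1 : ∫ x in S, (c * u x + c * k * (x * u x)) ≤ ∫ x in S, u x * tailIntegral u x ^ (1 / N) :=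
    setIntegral_mono_on hlin.integrableOn hG H.isOpen.measurableSet fun x hx => by
      linarith [mul_le_mul_of_nonneg_left (hle x hx) (H.density_nonneg x)]
  rw [setIntegral_eq_integral_of_forall_compl_eq_zero fun x hx => by rw [H.eq_zero x hx]; ring,
    integral_add (H.integrable.const_mul c) ((H.integrable_mul hN hmass).const_mul _),
    integral_const_mul, integral_const_mul, hmass, hbar] at h1
  have h2 : c ≤ N / (N + 1) := by
    have h : 1 / N + 1 = (N + 1) / N := by rw [add_div, div_self hN0, add_comm]
    rw [h, one_div_div] at hGle
    linarith
  have h3 := Real.rpow_le_rpow_of_nonpos (by positivity) h2 (by linarith : N ≤ 0)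
  rwa [hc, ← Real.rpow_mul hT.le, one_div_mul_cancel hN0, Real.rpow_one] at h3

end IsConvexPowerDensity

theorem isOpen_erealIoo (a b : EReal) : IsOpen (erealIoo a b) :=
  isOpen_Ioo.preimage continuous_coe_real_ereal

/-- One-dimensional Grünbaum inequality for densities with negative effective
dimension `N < -1`: a probability density `w` on a (possibly unbounded) interval
`(a,b)` with barycenter `0` such that `w^{1/(N-1)}` is convex satisfies
`∫_a^0 w ≥ (N/(N+1))^N` and `∫_0^b w ≥ (N/(N+1))^N`. -/
theorem grunbaum_one_dim_neg (N : ℝ) (a b : EReal) (w : ℝ → ℝ)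
    (hN : N < -1) (ha : a < (0 : EReal)) (hb : (0 : EReal) < b)
    (hw : ∀ x ∈ erealIoo a b, 0 < w x)
    (hint : IntegrableOn w (erealIoo a b))
    (hconv : ConvexOn ℝ (erealIoo a b) (fun x => w x ^ (1 / (N - 1))))
    (hmass : ∫ x in erealIoo a b, w x = 1)
    (hbar : ∫ x in erealIoo a b, x * w x = 0) :
    (N / (N + 1)) ^ N ≤ ∫ x in erealIoo a b ∩ Set.Iio (0 : ℝ), w x ∧
      (N / (N + 1)) ^ N ≤ ∫ x in erealIoo a b ∩ Set.Ioi (0 : ℝ), w x := by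
  have hopen := isOpen_erealIoo a b
  set S := erealIoo a b with hS
  have hmeas := hopen.measurableSet
  have hN1 : N - 1 ≠ 0 := by linarith
  have H : IsConvexPowerDensity N S (fun x => w x ^ (1 / (N - 1))) (S.indicator w) :=
    { isOpen := hopen
      zero_mem := ⟨ha, hb⟩
      convexOn := hconv
      pos := fun x hx => Real.rpow_pos_of_pos (hw x hx) _
      eq_rpow := fun x hx => by
        rw [indicator_of_mem hx, ← Real.rpow_mul (hw x hx).le, one_div_mul_cancel hN1,
          Real.rpow_one]
      eq_zero := fun x hx => indicator_of_notMem hx w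
      integrable := (integrable_indicator_iff hmeas).2 hint }
  have hmass' : ∫ x, S.indicator w x = 1 := by rw [integral_indicator hmeas, hmass]
  have hbar' : ∫ x, x * S.indicator w x = 0 := by
    rw [← hbar, ← integral_indicator hmeas]
    congr 1 with x
    by_cases hx : x ∈ S <;> simp [hx]
  constructor
  · have h := H.comp_neg.rpow_le_tailIntegral_zero hN
      (by rw [integral_neg_eq_self (S.indicator w) volume, hmass'])
      (by
        have := integral_neg_eq_self (fun x => x * S.indicator w x) volume
        rw [hbar'] at this
        simpa [integral_neg] using this)
    rwa [tailIntegral, integral_comp_neg_Ioi, neg_zero, integral_Iic_eq_integral_Iio,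
      setIntegral_indicator hmeas, inter_comm] at h
  · have h := H.rpow_le_tailIntegral_zero hN hmass' hbar'
    rwa [tailIntegral, setIntegral_indicator hmeas, inter_comm] at h
end

section
/- Let N < −1 be a real number, let a < b be real numbers, and let w : (a,b) → (0,∞) be an integrable function such that x ↦ w(x)^{1/(N-1)} is convex on (a,b). Define R(x) := ∫_a^x w(s) ds for x ∈ (a,b). Then the function x ↦ R(x)^{1/N} is convex on (a,b). -/
open MeasureTheory

/-- A positive convex function that decreases by a factor `t = g y / g x` from `x` to `y`
satisfies `g (y + t * (s - x)) ≤ t * g s` to the left of `x`. -/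
lemma ConvexOn.apply_homothety_le {S : Set ℝ} {g : ℝ → ℝ} (hg : ConvexOn ℝ S g)
    {s x y : ℝ} (hs : s ∈ S) (hy : y ∈ S) (hsx : s < x) (hxy : x < y)
    (hgx : 0 < g x) (hgy : 0 < g y) (hyx : g y ≤ g x) :
    g (y + g y / g x * (s - x)) ≤ g y / g x * g s := by
  set t := g y / g x
  have ht0 : 0 < t := div_pos hgy hgx
  have ht1 : t ≤ 1 := (div_le_one hgx).2 hyx
  have htg : t * g x = g y := div_mul_cancel₀ _ hgx.ne'
  have hd : 0 < y - s := by linarith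
  have chord : (y - s) * g x ≤ (y - x) * g s + (x - s) * g y := by
    have h := hg.2 hs hy
      (show 0 ≤ (y - x) / (y - s) from div_nonneg (by linarith) hd.le)
      (show 0 ≤ (x - s) / (y - s) from div_nonneg (by linarith) hd.le)
      (by field_simp; ring)
    have e : (y - x) / (y - s) * s + (x - s) / (y - s) * y = x := by field_simp; ring
    simp only [smul_eq_mul] at h
    rw [e] at h
    have h' := mul_le_mul_of_nonneg_left h hd.le
    have e' : (y - s) * ((y - x) / (y - s) * g s + (x - s) / (y - s) * g y)
        = (y - x) * g s + (x - s) * g y := by field_simp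
    linarith
  have htx : t * (x - s) ≤ y - s := by nlinarith
  have h := hg.2 hs hy
    (show 0 ≤ t * (x - s) / (y - s) from
      div_nonneg (mul_nonneg ht0.le (by linarith)) hd.le)
    (sub_nonneg.2 ((div_le_one hd).2 htx)) (by ring)
  have e : t * (x - s) / (y - s) * s + (1 - t * (x - s) / (y - s)) * y
      = y + t * (s - x) := by field_simp; ring
  simp only [smul_eq_mul] at h
  rw [e] at h
  refine h.trans ?_
  have e' : t * (x - s) / (y - s) * g s + (1 - t * (x - s) / (y - s)) * g y
      = (t * (x - s) * g s + (y - s - t * (x - s)) * g y) / (y - s) := by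
    field_simp
  rw [e', div_le_iff₀ hd]
  have h2 := mul_le_mul_of_nonneg_left chord ht0.le
  have h3 : t * ((y - s) * g x) = (y - s) * g y := by rw [← htg]; ring
  nlinarith

/-- If `w = g ^ (N - 1)` with `g` positive and convex and `g y ≤ g x`, then the distribution
function of `w` grows from `x` to `y` at least by the factor `(g y / g x) ^ N`. -/
lemma rpow_mul_integral_le_integral {N a b : ℝ} {g w : ℝ → ℝ} (hN : N < 1)
    (hgpos : ∀ x ∈ Set.Ioo a b, 0 < g x) (hg : ConvexOn ℝ (Set.Ioo a b) g)
    (hwg : ∀ x ∈ Set.Ioo a b, w x = g x ^ (N - 1))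
    (hint : IntegrableOn w (Set.Ioo a b)) {x y : ℝ}
    (hx : x ∈ Set.Ioo a b) (hy : y ∈ Set.Ioo a b) (hxy : x < y) (hyx : g y ≤ g x) :
    (g y / g x) ^ N * ∫ s in a..x, w s ≤ ∫ s in a..y, w s := by
  have hgx := hgpos x hx
  have hgy := hgpos y hy
  have hbound := fun s (hs : s ∈ Set.Ioo a x) =>
    hg.apply_homothety_le ⟨hs.1, hs.2.trans hx.2⟩ hy hs.2 hxy hgx hgy hyx
  set t := g y / g x
  have ht0 : 0 < t := div_pos hgy hgx
  have ht1 : t ≤ 1 := (div_le_one hgx).2 hyx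
  have hax : 0 < x - a := sub_pos.2 hx.1
  have hc : a < y + t * (a - x) := by nlinarith
  have hcy : y + t * (a - x) < y := by nlinarith
  have hii : ∀ u v, a ≤ u → u ≤ v → v ≤ b → IntervalIntegrable w volume u v := by
    intro u v hu huv hv
    rw [intervalIntegrable_iff_integrableOn_Ioo_of_le huv]
    exact hint.mono_set (Set.Ioo_subset_Ioo hu hv)
  have hpoint : ∀ s ∈ Set.Ioo a x, t ^ (N - 1) * w s ≤ w (t * s + (y - t * x)) := by
    intro s hs
    have hsI : s ∈ Set.Ioo a b := ⟨hs.1, hs.2.trans hx.2⟩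
    have e : t * s + (y - t * x) = y + t * (s - x) := by ring
    have hTs : y + t * (s - x) ∈ Set.Ioo a b := by
      constructor
      · nlinarith [hs.1]
      · nlinarith [hs.2, hy.2]
    rw [e, hwg _ hTs, hwg s hsI, ← Real.mul_rpow ht0.le (hgpos s hsI).le]
    exact Real.rpow_le_rpow_of_nonpos (hgpos _ hTs) (hbound s hs) (by linarith)
  have hcomp : IntervalIntegrable (fun s => w (t * s + (y - t * x))) volume a x := by
    have h := (((hii (y + t * (a - x)) y hc.le hcy.le hy.2.le).comp_add_right
      (y - t * x)).comp_mul_left (c := t))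
    have e1 : (y + t * (a - x) - (y - t * x)) / t = a := by field_simp; ring
    have e2 : (y - (y - t * x)) / t = x := by field_simp; ring
    rwa [e1, e2] at h
  have hmono : ∫ s in a..x, t ^ (N - 1) * w s ≤ ∫ s in a..x, w (t * s + (y - t * x)) :=
    intervalIntegral.integral_mono_on_of_le_Ioo hx.1.le
      ((hii a x le_rfl hx.1.le hx.2.le).const_mul _) hcomp hpoint
  rw [intervalIntegral.integral_const_mul,
    intervalIntegral.integral_comp_mul_add w ht0.ne' (y - t * x), smul_eq_mul] at hmono
  have e1 : t * a + (y - t * x) = y + t * (a - x) := by ring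
  have e2 : t * x + (y - t * x) = y := by ring
  rw [e1, e2] at hmono
  have hsplit := intervalIntegral.integral_add_adjacent_intervals
    (hii a (y + t * (a - x)) le_rfl hc.le (hcy.le.trans hy.2.le))
    (hii (y + t * (a - x)) y hc.le hcy.le hy.2.le)
  have hnn : 0 ≤ ∫ s in a..(y + t * (a - x)), w s := by
    rw [intervalIntegral.integral_of_le hc.le]
    refine setIntegral_nonneg measurableSet_Ioc fun s hs => ?_
    have hsI : s ∈ Set.Ioo a b := ⟨hs.1, hs.2.trans_lt (hcy.trans hy.2)⟩
    rw [hwg s hsI]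
    exact Real.rpow_nonneg (hgpos s hsI).le _
  calc t ^ N * ∫ s in a..x, w s = t * (t ^ (N - 1) * ∫ s in a..x, w s) := by
        rw [Real.rpow_sub_one ht0.ne']; field_simp
    _ ≤ t * (t⁻¹ * ∫ s in (y + t * (a - x))..y, w s) :=
        mul_le_mul_of_nonneg_left hmono ht0.le
    _ = ∫ s in (y + t * (a - x))..y, w s := mul_inv_cancel_left₀ ht0.ne' _
    _ ≤ ∫ s in a..y, w s := by linarith

/-- If `w : (a,b) → (0,∞)` is integrable and `w^{1/(N-1)}` is convex for some `N < -1`,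
then the cumulative distribution function `R(x) = ∫_a^x w` satisfies that `R^{1/N}`
is convex on `(a,b)`. -/
theorem cdf_rpow_convex (N a b : ℝ) (w : ℝ → ℝ)
    (hN : N < -1) (hab : a < b)
    (hw : ∀ x ∈ Set.Ioo a b, 0 < w x)
    (hint : IntegrableOn w (Set.Ioo a b))
    (hconv : ConvexOn ℝ (Set.Ioo a b) (fun x => w x ^ (1 / (N - 1)))) :
    ConvexOn ℝ (Set.Ioo a b) (fun x => (∫ s in Set.Ioo a x, w s) ^ (1 / N)) := by
  set g : ℝ → ℝ := fun x => w x ^ (1 / (N - 1))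
  have hN0 : N < 0 := by linarith
  have hN1 : N - 1 ≠ 0 := by linarith
  have hgpos : ∀ x ∈ Set.Ioo a b, 0 < g x := fun x hx => Real.rpow_pos_of_pos (hw x hx) _
  have hwg : ∀ x ∈ Set.Ioo a b, w x = g x ^ (N - 1) := fun x hx => by
    simp only [g]
    rw [← Real.rpow_mul (hw x hx).le, one_div_mul_cancel hN1, Real.rpow_one]
  have hwcont : ContinuousOn w (Set.Ioo a b) :=
    ((hconv.continuousOn isOpen_Ioo).rpow_const fun x hx => Or.inl (hgpos x hx).ne').congr hwg
  have hii : ∀ x ∈ Set.Ioo a b, IntervalIntegrable w volume a x := fun x hx => by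
    rw [intervalIntegrable_iff_integrableOn_Ioo_of_le hx.1.le]
    exact hint.mono_set (Set.Ioo_subset_Ioo le_rfl hx.2.le)
  have hRpos : ∀ x ∈ Set.Ioo a b, 0 < ∫ s in a..x, w s := fun x hx =>
    intervalIntegral.intervalIntegral_pos_of_pos_on (hii x hx)
      (fun s hs => hw s ⟨hs.1, hs.2.trans hx.2⟩) hx.1
  have hderiv : ∀ x ∈ Set.Ioo a b, HasDerivAt (fun x => (∫ s in a..x, w s) ^ (1 / N))
      (w x * (1 / N) * (∫ s in a..x, w s) ^ (1 / N - 1)) x := fun x hx =>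
    (intervalIntegral.integral_hasDerivAt_right (hii x hx)
      (hwcont.stronglyMeasurableAtFilter isOpen_Ioo x hx)
      (hwcont.continuousAt (isOpen_Ioo.mem_nhds hx))).rpow_const (Or.inl (hRpos x hx).ne')
  have hanti : ∀ x ∈ Set.Ioo a b, ∀ y ∈ Set.Ioo a b, x < y →
      w y * (∫ s in a..y, w s) ^ (1 / N - 1) ≤ w x * (∫ s in a..x, w s) ^ (1 / N - 1) := by
    intro x hx y hy hxy
    have hexp : 1 / N - 1 ≤ 0 := by
      have : 1 / N < 0 := one_div_neg.2 hN0
      linarith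
    rcases le_total (g x) (g y) with h | h
    · have hwyx : w y ≤ w x := by
        rw [hwg x hx, hwg y hy]
        exact Real.rpow_le_rpow_of_nonpos (hgpos x hx) h (by linarith)
      have hR : ∫ s in a..x, w s ≤ ∫ s in a..y, w s :=
        intervalIntegral.integral_mono_interval le_rfl hx.1.le hxy.le
          ((ae_restrict_iff' measurableSet_Ioc).2 (.of_forall fun s hs =>
            (hw s ⟨hs.1, hs.2.trans_lt hy.2⟩).le)) (hii y hy)
      exact mul_le_mul hwyx (Real.rpow_le_rpow_of_nonpos (hRpos x hx) hR hexp)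
        (Real.rpow_nonneg (hRpos y hy).le _) (hw x hx).le
    · have hR := rpow_mul_integral_le_integral (by linarith) hgpos hconv hwg hint hx hy hxy h
      have ht0 : 0 < g y / g x := div_pos (hgpos y hy) (hgpos x hx)
      have hwy : w y = (g y / g x) ^ (N - 1) * w x := by
        rw [hwg x hx, hwg y hy, ← Real.mul_rpow ht0.le (hgpos x hx).le,
          div_mul_cancel₀ _ (hgpos x hx).ne']
      have hpow := Real.rpow_le_rpow_of_nonpos
        (mul_pos (Real.rpow_pos_of_pos ht0 N) (hRpos x hx)) hR hexp
      rw [Real.mul_rpow (Real.rpow_nonneg ht0.le _) (hRpos x hx).le,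
        ← Real.rpow_mul ht0.le] at hpow
      have hNexp : N * (1 / N - 1) = -(N - 1) := by
        have := hN0.ne
        field_simp
        ring
      rw [hNexp, Real.rpow_neg ht0.le] at hpow
      refine (mul_le_mul_of_nonneg_left hpow (hw y hy).le).trans_eq ?_
      have := (Real.rpow_pos_of_pos ht0 (N - 1)).ne'
      rw [hwy]
      field_simp
  have key : ConvexOn ℝ (Set.Ioo a b) (fun x => (∫ s in a..x, w s) ^ (1 / N)) := by
    refine MonotoneOn.convexOn_of_deriv (convex_Ioo a b)
      (fun x hx => (hderiv x hx).continuousAt.continuousWithinAt) ?_ ?_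
    · rw [interior_Ioo]
      exact fun x hx => (hderiv x hx).differentiableAt.differentiableWithinAt
    · rw [interior_Ioo]
      intro x hx y hy hxy
      rcases hxy.eq_or_lt with rfl | hlt
      · exact le_rfl
      rw [(hderiv x hx).deriv, (hderiv y hy).deriv, mul_right_comm, mul_right_comm (w y)]
      exact mul_le_mul_of_nonpos_right (hanti x hx y hy hlt) (one_div_neg.2 hN0).le
  refine key.congr fun x hx => ?_
  simp only [intervalIntegral.integral_of_le hx.1.le, integral_Ioc_eq_integral_Ioo]
end

section
/- Let a < b be real numbers and let w : (a,b) → (0,∞) be an integrable function such that x ↦ log w(x) is concave on (a,b). Define R(x) := ∫_a^x w(s) ds for x ∈ (a,b). Then the function x ↦ log R(x) is concave on (a,b). -/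
open MeasureTheory

/-- For a concave function, the inner pair of two pairs of points with equal sums has the larger
sum of values. -/
theorem ConcaveOn.add_le_add_of_shift {S : Set ℝ} {f : ℝ → ℝ} (hf : ConcaveOn ℝ S f)
    {s x t : ℝ} (hsx : s ≤ x) (ht : 0 < t) (hs : s ∈ S) (hxt : x + t ∈ S) :
    f s + f (x + t) ≤ f x + f (s + t) := by
  have hd : 0 < x + t - s := by linarith
  have hp : 0 ≤ t / (x + t - s) := by positivity
  have hq : 0 ≤ (x - s) / (x + t - s) := div_nonneg (by linarith) hd.le
  have hpq : t / (x + t - s) + (x - s) / (x + t - s) = 1 := by field_simp; ring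
  have h₁ := hf.2 hs hxt hp hq hpq
  have h₂ := hf.2 hs hxt hq hp (by linarith)
  have e₁ : t / (x + t - s) * s + (x - s) / (x + t - s) * (x + t) = x := by field_simp; ring
  have e₂ : (x - s) / (x + t - s) * s + t / (x + t - s) * (x + t) = s + t := by field_simp; ring
  simp only [smul_eq_mul, e₁, e₂] at h₁ h₂
  linear_combination h₁ + h₂ - (f s + f (x + t)) * hpq

/-- A positive log-concave function on an open interval is continuous there. -/
theorem continuousOn_of_concaveOn_log {S : Set ℝ} {w : ℝ → ℝ} (hS : IsOpen S)
    (hw : ∀ x ∈ S, 0 < w x) (hconc : ConcaveOn ℝ S (fun x => Real.log (w x))) :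
    ContinuousOn w S :=
  (Real.continuous_exp.comp_continuousOn (hconc.continuousOn hS)).congr
    fun x hx => (Real.exp_log (hw x hx)).symm

/-- For a log-concave density `w`, the ratio of `w` to its cumulative distribution function is
nonincreasing, in cross-multiplied form. -/
theorem mul_integral_le_mul_integral_of_concaveOn_log {a b : ℝ} {w : ℝ → ℝ}
    (hw : ∀ x ∈ Set.Ioo a b, 0 < w x) (hint : IntegrableOn w (Set.Ioo a b))
    (hconc : ConcaveOn ℝ (Set.Ioo a b) (fun x => Real.log (w x)))
    {x y : ℝ} (hax : a < x) (hxy : x < y) (hyb : y < b) :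
    w y * (∫ s in a..x, w s) ≤ w x * ∫ s in a..y, w s := by
  have hI : ∀ u v, a ≤ u → u ≤ v → v < b → IntervalIntegrable w volume u v :=
    fun u v hu huv hv => (intervalIntegrable_iff_integrableOn_Ioo_of_le huv).2
      (hint.mono_set (Set.Ioo_subset_Ioo hu hv.le))
  have hshift : IntervalIntegrable (fun s => w (s + (y - x))) volume a x := by
    have := (hI (a + (y - x)) y (by linarith) (by linarith) hyb).comp_add_right (y - x)
    simpa using this
  have hle : (∫ s in (a + (y - x))..y, w s) ≤ ∫ s in a..y, w s := by
    have h0 : 0 ≤ ∫ s in a..(a + (y - x)), w s := by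
      rw [intervalIntegral.integral_of_le (by linarith)]
      exact setIntegral_nonneg measurableSet_Ioc
        fun s hs => (hw s ⟨hs.1, by linarith [hs.2]⟩).le
    have := intervalIntegral.integral_add_adjacent_intervals
      (hI a (a + (y - x)) le_rfl (by linarith) (by linarith))
      (hI (a + (y - x)) y (by linarith) (by linarith) hyb)
    linarith
  calc w y * (∫ s in a..x, w s) = ∫ s in a..x, w y * w s :=
        (intervalIntegral.integral_const_mul _ _).symm
    _ ≤ ∫ s in a..x, w x * w (s + (y - x)) := by
        refine intervalIntegral.integral_mono_on_of_le_Ioo hax.le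
          ((hI a x le_rfl hax.le (hxy.trans hyb)).const_mul _) (hshift.const_mul _) ?_
        intro s hs
        have hws := hw s ⟨hs.1, by linarith [hs.2]⟩
        have hwx := hw x ⟨hax, hxy.trans hyb⟩
        have hwy := hw y ⟨hax.trans hxy, hyb⟩
        have hwt := hw (s + (y - x)) ⟨by linarith [hs.1], by linarith [hs.2]⟩
        have h := hconc.add_le_add_of_shift hs.2.le (sub_pos.2 hxy)
          ⟨hs.1, by linarith [hs.2]⟩ ⟨by linarith, by linarith⟩
        rw [add_sub_cancel, ← Real.log_mul hws.ne' hwy.ne', ← Real.log_mul hwx.ne' hwt.ne',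
          Real.log_le_log_iff (by positivity) (by positivity)] at h
        linarith
    _ = w x * ∫ s in (a + (y - x))..y, w s := by
        rw [intervalIntegral.integral_const_mul, intervalIntegral.integral_comp_add_right]
        simp
    _ ≤ w x * ∫ s in a..y, w s :=
        mul_le_mul_of_nonneg_left hle (hw x ⟨hax, hxy.trans hyb⟩).le

/-- If `w : (a,b) → (0,∞)` is integrable and `log w` is concave, then the cumulative
distribution function `R(x) = ∫_a^x w` satisfies that `log R` is concave on `(a,b)`. -/
theorem cdf_log_concave (a b : ℝ) (w : ℝ → ℝ) (hab : a < b)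
    (hw : ∀ x ∈ Set.Ioo a b, 0 < w x)
    (hint : IntegrableOn w (Set.Ioo a b))
    (hconc : ConcaveOn ℝ (Set.Ioo a b) (fun x => Real.log (w x))) :
    ConcaveOn ℝ (Set.Ioo a b) (fun x => Real.log (∫ s in Set.Ioo a x, w s)) := by
  have hcont := continuousOn_of_concaveOn_log isOpen_Ioo hw hconc
  have hI : ∀ x ∈ Set.Ioo a b, IntervalIntegrable w volume a x := fun x hx =>
    (intervalIntegrable_iff_integrableOn_Ioo_of_le hx.1.le).2
      (hint.mono_set (Set.Ioo_subset_Ioo_right hx.2.le))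
  have hpos : ∀ x ∈ Set.Ioo a b, 0 < ∫ s in a..x, w s := fun x hx =>
    intervalIntegral.intervalIntegral_pos_of_pos_on (hI x hx)
      (fun s hs => hw s ⟨hs.1, hs.2.trans hx.2⟩) hx.1
  have hderiv : ∀ x ∈ Set.Ioo a b,
      HasDerivAt (fun x => Real.log (∫ s in a..x, w s)) (w x / ∫ s in a..x, w s) x :=
    fun x hx => (intervalIntegral.integral_hasDerivAt_right (hI x hx)
      (hcont.stronglyMeasurableAtFilter isOpen_Ioo x hx)
      (hcont.continuousAt (isOpen_Ioo.mem_nhds hx))).log (hpos x hx).ne'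
  have hlog : ConcaveOn ℝ (Set.Ioo a b) (fun x => Real.log (∫ s in a..x, w s)) := by
    refine AntitoneOn.concaveOn_of_deriv (convex_Ioo a b)
      (fun x hx => (hderiv x hx).continuousAt.continuousWithinAt) ?_ ?_ <;> rw [interior_Ioo]
    · exact fun x hx => (hderiv x hx).differentiableAt.differentiableWithinAt
    · intro x hx y hy hxy
      rw [(hderiv x hx).deriv, (hderiv y hy).deriv, div_le_div_iff₀ (hpos y hy) (hpos x hx)]
      rcases hxy.eq_or_lt with rfl | hlt
      · exact le_rfl
      · exact mul_integral_le_mul_integral_of_concaveOn_log hw hint hconc hx.1 hlt hy.2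
  refine hlog.congr fun x hx => ?_
  simp only [intervalIntegral.integral_of_le hx.1.le, integral_Ioc_eq_integral_Ioo]
end

section
/- Let (X, d) be a metric space equipped with a Borel measure m such that m(U) ∈ (0, ∞) for every nonempty bounded open set U ⊆ X, and suppose there exists N ∈ (1, ∞) such that the Bishop–Gromov inequality m(B(x,R)) ≤ (R/r)^N · m(B(x,r)) holds for all x ∈ X and all 0 < r < R, where B(x,r) denotes the open ball of center x and radius r. If m(X) < ∞, then X has finite diameter. -/
open MeasureTheory

open Filter Topology in
/-- The ratio of the volumes bounding an annulus of fixed width tends to one. -/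
theorem tendsto_add_one_div_sub_one_rpow (N : ℝ) :
    Tendsto (fun D : ℝ => ((D + 1) / (D - 1)) ^ N) atTop (𝓝 1) := by
  have h : Tendsto (fun D : ℝ => 1 + 2 / (D - 1)) atTop (𝓝 (1 + 0)) :=
    ((tendsto_atTop_add_const_right atTop (-1 : ℝ) tendsto_id).const_div_atTop 2).const_add 1
  rw [add_zero] at h
  have h' := h.rpow_const (p := N) (Or.inl one_ne_zero)
  rw [Real.one_rpow] at h'
  refine h'.congr' ?_
  filter_upwards [eventually_gt_atTop 1] with D hD
  have : D - 1 ≠ 0 := by linarith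
  congr 1
  field_simp
  ring

/-- Under Bishop–Gromov, the unit ball around `x₀` fits into a thin annulus around any
distant point `x`, which bounds its volume by a small multiple of the total volume. -/
theorem measureReal_ball_one_le_of_bishopGromov {X : Type*} [MetricSpace X]
    [MeasurableSpace X] [BorelSpace X] (m : Measure X) [IsFiniteMeasure m] {N : ℝ} (hN : 0 ≤ N)
    (hBG : ∀ x : X, ∀ r R : ℝ, 0 < r → r < R →
      m (Metric.ball x R) ≤ ENNReal.ofReal ((R / r) ^ N) * m (Metric.ball x r))
    {x₀ x : X} (hx : 1 < dist x x₀) :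
    m.real (Metric.ball x₀ 1) ≤
      (((dist x x₀ + 1) / (dist x x₀ - 1)) ^ N - 1) * m.real Set.univ := by
  set D := dist x x₀ with hD
  have hr : 0 < D - 1 := by linarith
  have hone : 1 ≤ ((D + 1) / (D - 1)) ^ N :=
    Real.one_le_rpow ((one_le_div hr).2 (by linarith)) hN
  have hBG' : m.real (Metric.ball x (D + 1)) ≤
      ((D + 1) / (D - 1)) ^ N * m.real (Metric.ball x (D - 1)) := by
    have h := ENNReal.toReal_mono (by finiteness) (hBG x (D - 1) (D + 1) hr (by linarith))
    rwa [ENNReal.toReal_mul, ENNReal.toReal_ofReal (by linarith)] at h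
  have hdisj : Disjoint (Metric.ball x₀ 1) (Metric.ball x (D - 1)) :=
    Metric.ball_disjoint_ball (by rw [dist_comm x₀ x]; linarith)
  have hsub : Metric.ball x₀ 1 ∪ Metric.ball x (D - 1) ⊆ Metric.ball x (D + 1) :=
    Set.union_subset (Metric.ball_subset_ball' (by rw [dist_comm x₀ x]; linarith))
      (Metric.ball_subset_ball (by linarith))
  have hadd := measureReal_union (μ := m) hdisj measurableSet_ball
  have hmono := measureReal_mono (μ := m) hsub
  calc m.real (Metric.ball x₀ 1)
      ≤ (((D + 1) / (D - 1)) ^ N - 1) * m.real (Metric.ball x (D - 1)) := by linarith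
    _ ≤ _ := mul_le_mul_of_nonneg_left (measureReal_mono (Set.subset_univ _)) (by linarith)

/-- A metric measure space (positive and finite on nonempty bounded open sets)
satisfying the Bishop–Gromov volume comparison inequality for some `N ∈ (1,∞)`
and having finite total measure has finite diameter. -/
theorem finite_diameter_of_bishopGromov {X : Type*} [MetricSpace X]
    [MeasurableSpace X] [BorelSpace X]
    (m : Measure X)
    (hm : ∀ U : Set X, IsOpen U → U.Nonempty → Bornology.IsBounded U →
      0 < m U ∧ m U < ⊤)
    (N : ℝ) (hN : 1 < N)
    (hBG : ∀ x : X, ∀ r R : ℝ, 0 < r → r < R →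
      m (Metric.ball x R) ≤ ENNReal.ofReal ((R / r) ^ N) * m (Metric.ball x r))
    (hfin : m Set.univ < ⊤) :
    EMetric.diam (Set.univ : Set X) < ⊤ := by
  have : IsFiniteMeasure m := ⟨hfin⟩
  rcases isEmpty_or_nonempty X with _ | ⟨⟨x₀⟩⟩
  · exact lt_top_iff_ne_top.2 (Set.toFinite (Set.univ : Set X)).isBounded.ediam_ne_top
  have hc : 0 < m.real (Metric.ball x₀ 1) :=
    ENNReal.toReal_pos (hm _ Metric.isOpen_ball (Metric.nonempty_ball.2 one_pos)
      Metric.isBounded_ball).1.ne' (by finiteness)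
  have hlim := ((tendsto_add_one_div_sub_one_rpow N).sub_const 1).mul_const (m.real Set.univ)
  rw [sub_self, zero_mul] at hlim
  obtain ⟨D₀, hD₀⟩ := Filter.eventually_atTop.1 (hlim.eventually_lt_const hc)
  have hbdd : Bornology.IsBounded (Set.univ : Set X) := by
    refine (Metric.isBounded_closedBall (x := x₀) (r := max D₀ 1)).subset ?_
    intro x _
    by_contra hx
    rw [Metric.mem_closedBall, not_le, max_lt_iff] at hx
    exact (hD₀ _ hx.1.le).not_ge
      (measureReal_ball_one_le_of_bishopGromov m (by linarith) hBG hx.2)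
  exact lt_top_iff_ne_top.2 hbdd.ediam_ne_top
end
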